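/- arXiv:2511.17438 — 6 statements merged into one kernel-verified Lean document; each statement's English description precedes it below -/
import Mathlib

section
/- Let d ≥ 2 be an integer and let B_1, …, B_d ∈ ℝ^{2×2} be matrices. For each k ∈ {1,…,d} let A_k ∈ ℝ^{(d+1)×(d+1)} be the embedding of B_k at coordinates 1 and k+1, i.e. [A_k]_{1,1} = [B_k]_{1,1}, [A_k]_{1,k+1} = [B_k]_{1,2}, [A_k]_{k+1,1} = [B_k]_{2,1}, [A_k]_{k+1,k+1} = [B_k]_{2,2}, [A_k]_{i,i} = 1 for i ∉ {1, k+1}, and all other entries equal 0. If there is a constant c with 0 < c ≤ 1 such that the spectral norm satisfies ‖B_k‖₂ ≤ c for every k ∈ {1,…,d}, then the spectral norm of the product A_d · A_{d−1} ⋯ A_1 satisfies ‖A_d A_{d−1} ⋯ A_1‖₂ ≤ c. -/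
/-- The spectral norm (operator norm induced by the Euclidean norm) of a real square
matrix. -/
noncomputable def specNorm {n : ℕ} (M : Matrix (Fin n) (Fin n) ℝ) : ℝ :=
  ‖Matrix.toEuclideanCLM (𝕜 := ℝ) M‖

/-- The embedding of a `2 × 2` matrix `B` at coordinates `1` and `k+1` (in 1-based
indexing, i.e. coordinates `0` and `k.succ` in 0-based indexing) of `ℝ^(d+1)`:
the `(d+1) × (d+1)` matrix acting as `B` on coordinates `(0, k.succ)` and as the
identity on the remaining coordinates. -/
def embedAt {d : ℕ} (B : Matrix (Fin 2) (Fin 2) ℝ) (k : Fin d) :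
    Matrix (Fin (d + 1)) (Fin (d + 1)) ℝ :=
  Matrix.of fun i j =>
    if i = 0 ∧ j = 0 then B 0 0
    else if i = 0 ∧ j = k.succ then B 0 1
    else if i = k.succ ∧ j = 0 then B 1 0
    else if i = k.succ ∧ j = k.succ then B 1 1
    else if i = j then 1 else 0

open Matrix in
theorem sum_sq_mulVec_le {n : ℕ} {M : Matrix (Fin n) (Fin n) ℝ} {c : ℝ}
    (hM : specNorm M ≤ c) (x : Fin n → ℝ) :
    ∑ i, (M *ᵥ x) i ^ 2 ≤ c ^ 2 * ∑ i, x i ^ 2 := by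
  have h := (Matrix.toEuclideanCLM (𝕜 := ℝ) M).le_of_opNorm_le hM (WithLp.toLp 2 x)
  have h2 := pow_le_pow_left₀ (norm_nonneg _) h 2
  rw [mul_pow, EuclideanSpace.real_norm_sq_eq, EuclideanSpace.real_norm_sq_eq] at h2
  simpa using h2

open Matrix in
theorem specNorm_le_of_sum_sq_mulVec_le {n : ℕ} {M : Matrix (Fin n) (Fin n) ℝ} {c : ℝ}
    (hc : 0 ≤ c) (h : ∀ x : Fin n → ℝ, ∑ i, (M *ᵥ x) i ^ 2 ≤ c ^ 2 * ∑ i, x i ^ 2) :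
    specNorm M ≤ c := by
  refine ContinuousLinearMap.opNorm_le_bound _ hc fun x => ?_
  refine le_of_sq_le_sq ?_ (by positivity)
  rw [mul_pow, EuclideanSpace.real_norm_sq_eq, EuclideanSpace.real_norm_sq_eq]
  simpa using h x.ofLp

section embedAt

open Matrix

variable {d : ℕ} (B : Matrix (Fin 2) (Fin 2) ℝ) (k : Fin d) (y : Fin (d + 1) → ℝ)

theorem embedAt_mulVec_zero :
    (embedAt B k *ᵥ y) 0 = B 0 0 * y 0 + B 0 1 * y k.succ := by
  simp [embedAt, mulVec, dotProduct, Fin.sum_univ_succ, (Fin.succ_ne_zero _).symm, ite_mul]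

theorem embedAt_mulVec_succ_self :
    (embedAt B k *ᵥ y) k.succ = B 1 0 * y 0 + B 1 1 * y k.succ := by
  simp +contextual [embedAt, mulVec, dotProduct, Fin.sum_univ_succ, ite_mul]
  rw [Finset.sum_eq_single k] <;> simp +contextual [eq_comm]

theorem embedAt_mulVec_succ_of_ne {i : Fin d} (hi : i ≠ k) :
    (embedAt B k *ᵥ y) i.succ = y i.succ := by
  simp [embedAt, mulVec, dotProduct, hi, ite_mul]

theorem embedAt_mulVec_sq_add_sq_le {B : Matrix (Fin 2) (Fin 2) ℝ} {c : ℝ}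
    (hB : specNorm B ≤ c) :
    (embedAt B k *ᵥ y) 0 ^ 2 + (embedAt B k *ᵥ y) k.succ ^ 2
      ≤ c ^ 2 * (y 0 ^ 2 + y k.succ ^ 2) := by
  rw [embedAt_mulVec_zero, embedAt_mulVec_succ_self]
  simpa [Fin.sum_univ_two, mulVec, dotProduct] using sum_sq_mulVec_le hB ![y 0, y k.succ]

end embedAt

open Matrix in
/-- Applying embedded contractions along distinct coordinates fixes the untouched coordinates
and contracts the touched ones; the weighted bound also holds for the empty list. -/
theorem prod_embedAt_mulVec_bounds {d : ℕ} {B : Fin d → Matrix (Fin 2) (Fin 2) ℝ} {c : ℝ}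
    (hc0 : 0 ≤ c) (hc1 : c ≤ 1) (hB : ∀ k, specNorm (B k) ≤ c) (x : Fin (d + 1) → ℝ)
    (r : List (Fin d)) (hr : r.Nodup) :
    let y := (r.map fun k => embedAt (B k) k).prod *ᵥ x
    (∀ i ∉ r, y i.succ = x i.succ) ∧
    c ^ 2 * y 0 ^ 2 + ∑ i ∈ r.toFinset, y i.succ ^ 2
      ≤ c ^ 2 * (x 0 ^ 2 + ∑ i ∈ r.toFinset, x i.succ ^ 2) ∧
    (r ≠ [] → y 0 ^ 2 + ∑ i ∈ r.toFinset, y i.succ ^ 2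
      ≤ c ^ 2 * (x 0 ^ 2 + ∑ i ∈ r.toFinset, x i.succ ^ 2)) := by
  induction r with
  | nil => simp
  | cons k r ih =>
    obtain ⟨hk, hr⟩ := List.nodup_cons.mp hr
    obtain ⟨hfix, hle, -⟩ := ih hr
    simp only [List.map_cons, List.prod_cons, ← mulVec_mulVec]
    set y := (r.map fun k => embedAt (B k) k).prod *ᵥ x
    have hstep := embedAt_mulVec_sq_add_sq_le k y (hB k)
    rw [hfix k hk] at hstep
    have hsum : ∑ i ∈ r.toFinset, (embedAt (B k) k *ᵥ y) i.succ ^ 2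
        = ∑ i ∈ r.toFinset, y i.succ ^ 2 :=
      Finset.sum_congr rfl fun i hi => by
        rw [embedAt_mulVec_succ_of_ne _ _ _ (by rintro rfl; simp_all)]
    have hkr : k ∉ r.toFinset := by simpa using hk
    rw [List.toFinset_cons, Finset.sum_insert hkr, Finset.sum_insert hkr, hsum]
    have hstrong : (embedAt (B k) k *ᵥ y) 0 ^ 2 + ((embedAt (B k) k *ᵥ y) k.succ ^ 2
        + ∑ i ∈ r.toFinset, y i.succ ^ 2)
        ≤ c ^ 2 * (x 0 ^ 2 + (x k.succ ^ 2 + ∑ i ∈ r.toFinset, x i.succ ^ 2)) := by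
      linarith
    refine ⟨fun i hi => ?_, ?_, fun _ => hstrong⟩
    · rw [List.mem_cons, not_or] at hi
      rw [embedAt_mulVec_succ_of_ne _ _ _ hi.1, hfix i hi.2]
    · have := mul_le_of_le_one_left (sq_nonneg ((embedAt (B k) k *ᵥ y) 0))
        (pow_le_one₀ hc0 hc1 (n := 2))
      linarith

/-- If `‖B_k‖₂ ≤ c ≤ 1` for all `k`, then the spectral norm of the product
`A_d ⋯ A_1` of the embedded matrices is at most `c`. -/
theorem spec_norm_prod_embed_le {d : ℕ} (hd : 2 ≤ d)
    (B : Fin d → Matrix (Fin 2) (Fin 2) ℝ) (c : ℝ) (hc0 : 0 < c) (hc1 : c ≤ 1)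
    (hB : ∀ k : Fin d, specNorm (B k) ≤ c) :
    specNorm ((List.ofFn fun k : Fin d => embedAt (B k) k).reverse.prod) ≤ c := by
  refine specNorm_le_of_sum_sq_mulVec_le hc0.le fun x => ?_
  have hne : (List.finRange d).reverse ≠ [] := by
    rw [Ne, List.reverse_eq_nil_iff, List.finRange_eq_nil_iff]
    omega
  have h := (prod_embedAt_mulVec_bounds hc0.le hc1 hB x (List.finRange d).reverse
    (List.nodup_reverse.mpr (List.nodup_finRange d))).2.2 hne
  rw [List.toFinset_reverse, List.toFinset_finRange, List.map_reverse] at h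
  rwa [Fin.sum_univ_succ, Fin.sum_univ_succ, List.ofFn_eq_map]
end

section
/- Fix an integer U ≥ 2 and, for each u ∈ {1,…,U}, a symmetric positive definite matrix Λ_u ∈ ℝ^{2×2} with entries a_u = [Λ_u]_{1,1}, b_u = [Λ_u]_{1,2}, d_u = [Λ_u]_{2,2}. Suppose that for every u ∈ {1,…,U} the condition b_u² < 4 a_u d_u² (Σ_{k=1}^U a_k) / (d_u + Σ_{k=1}^U a_k)² holds. Let (μ_m, τ_m) be the state of the marginalized Gaussian Bayes recursion after m full iterations, started from an arbitrary mean vector μ_0 ∈ ℝ^{U+1} and arbitrary positive initial precisions τ_0 ∈ (0,∞)^{U+1}. Then |μ_m|₂ → 0 as m → ∞, and every coordinate of τ_m tends to +∞ as m → ∞. (Equivalently: iterating the marginalized Bayes map on Gaussian distributions whose unit likelihoods are Gaussian with precisions Λ_u and common maximizer translated to the origin converges in probability to a point mass at the maximum likelihood estimate.) -/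
/-- One sub-iteration of the marginalized Gaussian Bayes recursion for unit `u`.
The state is a pair `(μ, τ)` where `μ : Fin (U+1) → ℝ` is the mean vector
(coordinate `0` for the shared parameter, coordinate `u.succ` for the `u`-th
unit-specific parameter) and `τ : Fin (U+1) → ℝ` is the vector of precisions.
The unit likelihood precision matrix is `Λ_u = !![a u, b u; b u, dd u]`. -/
noncomputable def subIter {U : ℕ} (a b dd : Fin U → ℝ) (u : Fin U)
    (st : (Fin (U + 1) → ℝ) × (Fin (U + 1) → ℝ)) :
    (Fin (U + 1) → ℝ) × (Fin (U + 1) → ℝ) :=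
  let μ := st.1
  let τ := st.2
  -- mean update matrix (diag(τ⁰, τᵘ) + Λᵤ)⁻¹ diag(τ⁰, τᵘ)
  let M : Matrix (Fin 2) (Fin 2) ℝ :=
    (!![τ 0 + a u, b u; b u, τ u.succ + dd u])⁻¹ * !![τ 0, 0; 0, τ u.succ]
  (fun i =>
      if i = 0 then M 0 0 * μ 0 + M 0 1 * μ u.succ
      else if i = u.succ then M 1 0 * μ 0 + M 1 1 * μ u.succ
      else μ i,
   fun i =>
      if i = 0 then τ 0 + a u - (b u) ^ 2 / (τ u.succ + dd u)
      else if i = u.succ then τ u.succ + dd u - (b u) ^ 2 / (τ 0 + a u)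
      else τ i)

/-- One full iteration of the marginalized Gaussian Bayes recursion: the
sub-iterations for units `u = 1, …, U` applied in order. -/
noncomputable def fullIter {U : ℕ} (a b dd : Fin U → ℝ)
    (st : (Fin (U + 1) → ℝ) × (Fin (U + 1) → ℝ)) :
    (Fin (U + 1) → ℝ) × (Fin (U + 1) → ℝ) :=
  (List.finRange U).foldl (fun s u => subIter a b dd u s) st

open Filter Topology

section SubIteration

variable {U : ℕ} {a b d : Fin U → ℝ} {u v : Fin U} {s : (Fin (U + 1) → ℝ) × (Fin (U + 1) → ℝ)}

lemma subIter_prec_zero :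
    (subIter a b d u s).2 0 = s.2 0 + a u - b u ^ 2 / (s.2 u.succ + d u) := by
  simp [subIter]

lemma subIter_prec_self :
    (subIter a b d u s).2 u.succ = s.2 u.succ + d u - b u ^ 2 / (s.2 0 + a u) := by
  simp [subIter, Fin.succ_ne_zero]

lemma subIter_prec_of_ne (h : v ≠ u) : (subIter a b d u s).2 v.succ = s.2 v.succ := by
  simp [subIter, Fin.succ_ne_zero, h]

lemma subIter_mean_of_ne (h : v ≠ u) : (subIter a b d u s).1 v.succ = s.1 v.succ := by
  simp [subIter, Fin.succ_ne_zero, h]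

lemma sq_div_add_lt {x y t z : ℝ} (hy : 0 < y) (ht : 0 < t) (h : z ^ 2 < x * y) :
    z ^ 2 / (t + y) < x := by
  rw [div_lt_iff₀ (by positivity)]
  have hx : 0 < x := pos_of_mul_pos_left ((sq_nonneg z).trans_lt h) hy.le
  nlinarith [mul_pos hx ht]

lemma subIter_prec_pos (ha : ∀ u, 0 < a u) (hd : ∀ u, 0 < d u)
    (hb : ∀ u, b u ^ 2 < a u * d u) (hs : ∀ i, 0 < s.2 i) :
    ∀ i, 0 < (subIter a b d u s).2 i := by
  intro i
  refine Fin.cases ?_ (fun v => ?_) i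
  · rw [subIter_prec_zero]
    linarith [hs 0, sq_div_add_lt (hd u) (hs u.succ) (hb u)]
  · by_cases h : v = u
    · subst h
      rw [subIter_prec_self]
      linarith [hs v.succ, sq_div_add_lt (ha v) (hs 0) (mul_comm (a v) (d v) ▸ hb v)]
    · rw [subIter_prec_of_ne h]
      exact hs _

lemma subIter_mean_equations (hdet : (s.2 0 + a u) * (s.2 u.succ + d u) - b u ^ 2 ≠ 0) :
    (s.2 0 + a u) * (subIter a b d u s).1 0 + b u * (subIter a b d u s).1 u.succ
      = s.2 0 * s.1 0 ∧
    b u * (subIter a b d u s).1 0 + (s.2 u.succ + d u) * (subIter a b d u s).1 u.succ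
      = s.2 u.succ * s.1 u.succ := by
  have hdet' : (s.2 0 + a u) * (s.2 u.succ + d u) - b u * b u ≠ 0 := by
    rwa [← sq]
  simp only [subIter, Matrix.inv_def, Matrix.det_fin_two_of, Matrix.adjugate_fin_two_of,
    Ring.inverse_eq_inv', Matrix.mul_apply, Fin.sum_univ_two, Matrix.smul_apply,
    Matrix.of_apply, Matrix.cons_val_zero, Matrix.cons_val_one, Matrix.cons_val', smul_eq_mul,
    if_true, Fin.succ_ne_zero, if_false, Matrix.cons_val_fin_one]
  constructor <;> field_simp <;> ring

end SubIteration

/-- A binary quadratic form with nonnegative diagonal and nonpositive discriminant is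
nonnegative. -/
lemma quadratic_form_nonneg {α β γ : ℝ} (hα : 0 < α) (h : β ^ 2 ≤ 4 * α * γ) (x y : ℝ) :
    0 ≤ α * x ^ 2 + β * (x * y) + γ * y ^ 2 := by
  have h4 : 0 ≤ 4 * α * (α * x ^ 2 + β * (x * y) + γ * y ^ 2) := by
    nlinarith [sq_nonneg (2 * α * x + β * y), mul_nonneg (sub_nonneg.2 h) (sq_nonneg y)]
  exact nonneg_of_mul_nonneg_right h4 (by positivity)

/-- If `ε` is a lower bound of the symmetric part of `D⁻¹ Λ`, then the Euclidean norm
contracts under `(D + Λ)⁻¹ D`. -/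
lemma sq_norm_contracts {a b d p t ε x y x' y' : ℝ} (hp : 0 < p) (ht : 0 < t)
    (h1 : ε < a / p)
    (h2 : (b * (1 / p + 1 / t)) ^ 2 ≤ 4 * (a / p - ε) * (d / t - ε))
    (e1 : (p + a) * x' + b * y' = p * x) (e2 : b * x' + (t + d) * y' = t * y) :
    (1 + 2 * ε) * (x' ^ 2 + y' ^ 2) ≤ x ^ 2 + y ^ 2 := by
  have hx : x = x' + (a / p * x' + b / p * y') := by
    field_simp
    linarith
  have hy : y = y' + (b / t * x' + d / t * y') := by
    field_simp
    linarith
  have hq := quadratic_form_nonneg (sub_pos.2 h1) h2 x' y'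
  have hb : b * (1 / p + 1 / t) = b / p + b / t := by ring
  rw [hb] at hq
  rw [hx, hy]
  nlinarith [sq_nonneg (a / p * x' + b / p * y'), sq_nonneg (b / t * x' + d / t * y')]

section Sweep

variable {U : ℕ} {a b d : Fin U → ℝ}

lemma foldl_subIter_prec_zero {l : List (Fin U)} (hl : l.Nodup)
    (s : (Fin (U + 1) → ℝ) × (Fin (U + 1) → ℝ)) :
    (l.foldl (fun s u => subIter a b d u s) s).2 0
      = s.2 0 + (l.map fun u => a u - b u ^ 2 / (s.2 u.succ + d u)).sum := by
  induction l generalizing s with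
  | nil => simp
  | cons u l ih =>
    obtain ⟨hu, hl⟩ := List.nodup_cons.1 hl
    have hmap : (l.map fun v => a v - b v ^ 2 / ((subIter a b d u s).2 v.succ + d v))
        = l.map fun v => a v - b v ^ 2 / (s.2 v.succ + d v) :=
      List.map_congr_left fun v hv => by
        rw [subIter_prec_of_ne (fun h : v = u => hu (h ▸ hv))]
    rw [List.foldl_cons, ih hl, hmap, subIter_prec_zero, List.map_cons, List.sum_cons]
    ring

lemma foldl_subIter_of_notMem {l : List (Fin U)} {u : Fin U} (hu : u ∉ l)
    (s : (Fin (U + 1) → ℝ) × (Fin (U + 1) → ℝ)) :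
    (l.foldl (fun s u => subIter a b d u s) s).1 u.succ = s.1 u.succ ∧
    (l.foldl (fun s u => subIter a b d u s) s).2 u.succ = s.2 u.succ := by
  induction l generalizing s with
  | nil => simp
  | cons v l ih =>
    rw [List.mem_cons, not_or] at hu
    rw [List.foldl_cons, (ih hu.2 _).1, (ih hu.2 _).2, subIter_mean_of_ne hu.1,
      subIter_prec_of_ne hu.1]
    exact ⟨rfl, rfl⟩

variable (ha : ∀ u, 0 < a u) (hd : ∀ u, 0 < d u) (hb : ∀ u, b u ^ 2 < a u * d u)
include ha hd hb

lemma foldl_subIter_prec_pos (l : List (Fin U))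
    {s : (Fin (U + 1) → ℝ) × (Fin (U + 1) → ℝ)} (hs : ∀ i, 0 < s.2 i) :
    ∀ i, 0 < (l.foldl (fun s u => subIter a b d u s) s).2 i := by
  induction l generalizing s with
  | nil => exact hs
  | cons u l ih => exact ih (subIter_prec_pos ha hd hb hs)

lemma foldl_subIter_prec_mem {l : List (Fin U)} (hl : l.Nodup) {u : Fin U} (hu : u ∈ l)
    {s : (Fin (U + 1) → ℝ) × (Fin (U + 1) → ℝ)} (hs : ∀ i, 0 < s.2 i) :
    ∃ q, s.2 0 ≤ q ∧ (l.foldl (fun s u => subIter a b d u s) s).2 u.succ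
      = s.2 u.succ + d u - b u ^ 2 / (q + a u) := by
  induction l generalizing s with
  | nil => simp at hu
  | cons v l ih =>
    obtain ⟨hv, hl⟩ := List.nodup_cons.1 hl
    rw [List.foldl_cons]
    by_cases h : u = v
    · subst h
      exact ⟨_, le_rfl, by rw [(foldl_subIter_of_notMem hv _).2, subIter_prec_self]⟩
    · obtain ⟨q, hq, e⟩ := ih hl (List.mem_of_ne_of_mem h hu) (subIter_prec_pos ha hd hb hs)
      rw [subIter_prec_of_ne h] at e
      refine ⟨q, le_trans ?_ hq, e⟩
      rw [subIter_prec_zero]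
      linarith [sq_div_add_lt (hd v) (hs v.succ) (hb v)]

/-- A sweep of sub-iterations, each of which contracts the squared Euclidean norm by the
factor `r`, contracts all unit-specific coordinates by `r`; the shared coordinate is
contracted too once there is at least one sub-iteration. -/
lemma foldl_subIter_sq_le {r P Q : ℝ} (hr : r ≤ 1) {l : List (Fin U)} (hl : l.Nodup)
    {s : (Fin (U + 1) → ℝ) × (Fin (U + 1) → ℝ)} (hs : ∀ i, 0 < s.2 i)
    (hP : P ≤ s.2 0) (hQ : s.2 0 + (l.map a).sum ≤ Q)
    (hc : ∀ u ∈ l, ∀ p, P ≤ p → p ≤ Q → ∀ x y x' y' : ℝ,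
      (p + a u) * x' + b u * y' = p * x →
      b u * x' + (s.2 u.succ + d u) * y' = s.2 u.succ * y →
      x' ^ 2 + y' ^ 2 ≤ r * (x ^ 2 + y ^ 2)) :
    (l.foldl (fun s u => subIter a b d u s) s).1 0 ^ 2
      + (l.map fun u => (l.foldl (fun s u => subIter a b d u s) s).1 u.succ ^ 2).sum
      ≤ (if l = [] then 1 else r) * s.1 0 ^ 2 + r * (l.map fun u => s.1 u.succ ^ 2).sum := by
  induction l generalizing s with
  | nil => simp
  | cons u l ih =>
    obtain ⟨hu, hl⟩ := List.nodup_cons.1 hl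
    have hne : ∀ v ∈ l, v ≠ u := fun v hv h => hu (h ▸ hv)
    have hsum : 0 ≤ (l.map a).sum :=
      List.sum_nonneg fun x hx => by
        obtain ⟨v, -, rfl⟩ := List.mem_map.1 hx
        exact (ha v).le
    rw [List.map_cons, List.sum_cons] at hQ
    have hdet : (s.2 0 + a u) * (s.2 u.succ + d u) - b u ^ 2 ≠ 0 := by
      have := hb u
      have := mul_pos (hs 0) (hs u.succ)
      have := mul_pos (hs 0) (hd u)
      have := mul_pos (ha u) (hs u.succ)
      nlinarith
    obtain ⟨e1, e2⟩ := subIter_mean_equations hdet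
    have hstep := hc u List.mem_cons_self _ hP (by linarith [ha u]) _ _ _ _ e1 e2
    have hdec : b u ^ 2 / (s.2 u.succ + d u) < a u := sq_div_add_lt (hd u) (hs u.succ) (hb u)
    have hpos : 0 ≤ b u ^ 2 / (s.2 u.succ + d u) :=
      div_nonneg (sq_nonneg _) (add_pos (hs _) (hd _)).le
    have hrec := ih hl (subIter_prec_pos (u := u) ha hd hb hs)
      (by rw [subIter_prec_zero]; linarith)
      (by rw [subIter_prec_zero]; linarith)
      (fun v hv p hp hp' x y x' y' f1 f2 => by
        rw [subIter_prec_of_ne (hne v hv)] at f2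
        exact hc v (List.mem_cons_of_mem _ hv) p hp hp' x y x' y' f1 f2)
    have hmap : (l.map fun v => (subIter a b d u s).1 v.succ ^ 2)
        = l.map fun v => s.1 v.succ ^ 2 :=
      List.map_congr_left fun v hv => by rw [subIter_mean_of_ne (hne v hv)]
    rw [hmap] at hrec
    have hite : (if l = [] then 1 else r) * (subIter a b d u s).1 0 ^ 2
        ≤ (subIter a b d u s).1 0 ^ 2 := by
      split_ifs
      · simp
      · nlinarith [sq_nonneg ((subIter a b d u s).1 0)]
    simp only [List.foldl_cons, List.map_cons, List.sum_cons, reduceCtorEq, if_false,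
      (foldl_subIter_of_notMem hu _).1]
    linarith

end Sweep

/-- A nonnegative sequence with `V (m + 1) ≤ V m / (1 + ε / (m + 1))` eventually tends to `0`,
since the harmonic series diverges. -/
lemma tendsto_zero_of_harmonic_contraction {V : ℕ → ℝ} {ε : ℝ} (hε : 0 < ε) (hV : ∀ m, 0 ≤ V m)
    (h : ∀ᶠ m : ℕ in atTop, (1 + ε / ((m : ℝ) + 1)) * V (m + 1) ≤ V m) :
    Tendsto V atTop (𝓝 0) := by
  obtain ⟨N, hN⟩ := eventually_atTop.1 h
  let H : ℕ → ℝ := fun m => ∑ i ∈ Finset.range m, 1 / ((i : ℝ) + 1)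
  have hH : Tendsto H atTop atTop := Real.tendsto_sum_range_one_div_nat_succ_atTop
  have hsucc : ∀ m, H (m + 1) = H m + 1 / ((m : ℝ) + 1) := fun m => Finset.sum_range_succ _ _
  have key : ∀ m, N ≤ m → 0 ≤ H m - H N ∧ (1 + ε * (H m - H N)) * V m ≤ V N := by
    intro m hm
    induction m, hm using Nat.le_induction with
    | base => simp
    | succ m hm ih =>
      have hpos : (0 : ℝ) < 1 / ((m : ℝ) + 1) := by positivity
      refine ⟨by rw [hsucc]; linarith [ih.1], le_trans ?_ ih.2⟩
      have h1 : 0 ≤ ε * (H m - H N) := mul_nonneg hε.le ih.1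
      refine le_trans ?_ (mul_le_mul_of_nonneg_left (hN m hm) (by linarith))
      rw [← mul_assoc]
      refine mul_le_mul_of_nonneg_right ?_ (hV _)
      rw [hsucc, div_eq_mul_one_div ε]
      nlinarith [mul_nonneg h1 (mul_pos hε hpos).le]
  have hden : Tendsto (fun m => 1 + ε * (H m - H N)) atTop atTop :=
    tendsto_atTop_add_const_left _ _
      ((tendsto_atTop_add_const_right _ (-H N) hH).const_mul_atTop hε)
  refine squeeze_zero' (Eventually.of_forall hV) ?_ (hden.const_div_atTop (V N))
  filter_upwards [eventually_ge_atTop N] with m hm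
  obtain ⟨h0, h1⟩ := key m hm
  rw [le_div_iff₀ (by positivity)]
  linarith

/-- A sequence whose increments converge to `c` grows like `c * m`. -/
lemma tendsto_div_nat_of_tendsto_sub {f : ℕ → ℝ} {c : ℝ}
    (h : Tendsto (fun m => f (m + 1) - f m) atTop (𝓝 c)) :
    Tendsto (fun m : ℕ => f m / m) atTop (𝓝 c) := by
  have h1 := h.cesaro
  have h2 : Tendsto (fun m : ℕ => f 0 / (m : ℝ)) atTop (𝓝 0) :=
    tendsto_const_div_atTop_nhds_zero_nat (f 0)
  have h3 := h1.add h2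
  rw [add_zero] at h3
  refine h3.congr fun m => ?_
  rw [Finset.sum_range_sub]
  ring

/-- A sequence whose increments are bounded below by a positive constant tends to `∞`. -/
lemma tendsto_atTop_of_add_le {f : ℕ → ℝ} {c : ℝ} (hc : 0 < c)
    (h : ∀ m, f m + c ≤ f (m + 1)) : Tendsto f atTop atTop := by
  have key : ∀ m : ℕ, f 0 + c * m ≤ f m := by
    intro m
    induction m with
    | zero => simp
    | succ m ih => push_cast; linarith [h m]
  exact tendsto_atTop_mono key (tendsto_atTop_add_const_left _ _
    (tendsto_natCast_atTop_atTop.const_mul_atTop hc))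

/-- Robust form of the discriminant condition: it persists for reciprocal rates close to
`1 / A` and `1 / d`. -/
lemma exists_discriminant_margin {a b d A : ℝ} (ha : 0 < a) (hd : 0 < d) (hA : 0 < A)
    (h : b ^ 2 < 4 * a * d ^ 2 * A / (d + A) ^ 2) :
    ∃ δ > 0, ∀ ε, 0 < ε → ε < δ → ∀ α β : ℝ, |α - A⁻¹| < δ → |β - d⁻¹| < δ →
      ε < a * α ∧ (b * (α + β)) ^ 2 ≤ 4 * (a * α - ε) * (d * β - ε) := by
  have c1 : Continuous fun z : ℝ × ℝ × ℝ => a * z.1 - z.2.2 := by fun_prop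
  have c2 : Continuous fun z : ℝ × ℝ × ℝ =>
      4 * (a * z.1 - z.2.2) * (d * z.2.1 - z.2.2) - (b * (z.1 + z.2.1)) ^ 2 := by fun_prop
  have p1 : 0 < a * A⁻¹ - 0 := by rw [sub_zero]; positivity
  have p2 : 0 < 4 * (a * A⁻¹ - 0) * (d * d⁻¹ - 0) - (b * (A⁻¹ + d⁻¹)) ^ 2 := by
    rw [lt_div_iff₀ (by positivity)] at h
    have e : 4 * (a * A⁻¹ - 0) * (d * d⁻¹ - 0) - (b * (A⁻¹ + d⁻¹)) ^ 2
        = (4 * a * d ^ 2 * A - b ^ 2 * (d + A) ^ 2) / (A ^ 2 * d ^ 2) := by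
      field_simp
      ring
    rw [e]
    exact div_pos (sub_pos.2 h) (by positivity)
  have e1 := (c1.tendsto (A⁻¹, d⁻¹, (0 : ℝ))).eventually (lt_mem_nhds p1)
  have e2 := (c2.tendsto (A⁻¹, d⁻¹, (0 : ℝ))).eventually (lt_mem_nhds p2)
  obtain ⟨δ, hδ, hball⟩ := Metric.eventually_nhds_iff.1 (e1.and e2)
  refine ⟨δ, hδ, fun ε hε hεδ α β hα hβ => ?_⟩
  have := @hball (α, β, ε) (by
    simp only [Prod.dist_eq, Real.dist_eq, sub_zero, max_lt_iff]
    exact ⟨hα, hβ, by rwa [abs_of_pos hε]⟩)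
  exact ⟨sub_pos.1 this.1, (sub_pos.1 this.2).le⟩

section FullIteration

variable {U : ℕ} {a b d : Fin U → ℝ}

lemma fullIter_prec_zero (s : (Fin (U + 1) → ℝ) × (Fin (U + 1) → ℝ)) :
    (fullIter a b d s).2 0
      = s.2 0 + ∑ u, (a u - b u ^ 2 / (s.2 u.succ + d u)) := by
  rw [fullIter, foldl_subIter_prec_zero (List.nodup_finRange U), Fin.sum_univ_def]

variable (ha : ∀ u, 0 < a u) (hd : ∀ u, 0 < d u) (hb : ∀ u, b u ^ 2 < a u * d u)
include ha hd hb

lemma iterate_fullIter_prec_pos {s : (Fin (U + 1) → ℝ) × (Fin (U + 1) → ℝ)}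
    (hs : ∀ i, 0 < s.2 i) (m : ℕ) : ∀ i, 0 < ((fullIter a b d)^[m] s).2 i := by
  induction m with
  | zero => exact hs
  | succ m ih =>
    rw [Function.iterate_succ_apply']
    exact foldl_subIter_prec_pos ha hd hb _ ih

lemma fullIter_prec_succ {s : (Fin (U + 1) → ℝ) × (Fin (U + 1) → ℝ)}
    (hs : ∀ i, 0 < s.2 i) (u : Fin U) :
    ∃ q, s.2 0 ≤ q ∧
      (fullIter a b d s).2 u.succ = s.2 u.succ + d u - b u ^ 2 / (q + a u) :=
  foldl_subIter_prec_mem ha hd hb (List.nodup_finRange U) (List.mem_finRange u) hs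

lemma fullIter_sq_le (hU : U ≠ 0) {r : ℝ} (hr : r ≤ 1)
    {s : (Fin (U + 1) → ℝ) × (Fin (U + 1) → ℝ)} (hs : ∀ i, 0 < s.2 i)
    (hc : ∀ u, ∀ p, s.2 0 ≤ p → p ≤ s.2 0 + ∑ k, a k → ∀ x y x' y' : ℝ,
      (p + a u) * x' + b u * y' = p * x →
      b u * x' + (s.2 u.succ + d u) * y' = s.2 u.succ * y →
      x' ^ 2 + y' ^ 2 ≤ r * (x ^ 2 + y ^ 2)) :
    ∑ i, (fullIter a b d s).1 i ^ 2 ≤ r * ∑ i, s.1 i ^ 2 := by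
  have h := foldl_subIter_sq_le ha hd hb hr (List.nodup_finRange U) hs le_rfl
    (by rw [← Fin.sum_univ_def]) (fun u _ => hc u)
  rw [if_neg (by rwa [List.finRange_eq_nil_iff]), ← Fin.sum_univ_def, ← Fin.sum_univ_def] at h
  rw [Fin.sum_univ_succ, Fin.sum_univ_succ, mul_add]
  exact h

lemma tendsto_iterate_prec_zero (hU : U ≠ 0) {s : (Fin (U + 1) → ℝ) × (Fin (U + 1) → ℝ)}
    (hs : ∀ i, 0 < s.2 i) :
    Tendsto (fun m => ((fullIter a b d)^[m] s).2 0) atTop atTop := by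
  have : NeZero U := ⟨hU⟩
  have hpos := iterate_fullIter_prec_pos ha hd hb hs
  refine tendsto_atTop_of_add_le (c := ∑ u, (a u - b u ^ 2 / d u))
    (Finset.sum_pos (fun u _ => ?_) Finset.univ_nonempty) fun m => ?_
  · rw [sub_pos, div_lt_iff₀ (hd u)]
    exact hb u
  · rw [Function.iterate_succ_apply', fullIter_prec_zero]
    gcongr with u
    · exact hd u
    · linarith [hpos m u.succ]

lemma tendsto_iterate_prec_succ {s : (Fin (U + 1) → ℝ) × (Fin (U + 1) → ℝ)}
    (hs : ∀ i, 0 < s.2 i) (u : Fin U) :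
    Tendsto (fun m => ((fullIter a b d)^[m] s).2 u.succ) atTop atTop := by
  have hpos := iterate_fullIter_prec_pos ha hd hb hs
  refine tendsto_atTop_of_add_le (c := d u - b u ^ 2 / a u) ?_ fun m => ?_
  · rw [sub_pos, div_lt_iff₀ (ha u), mul_comm]
    exact hb u
  · rw [Function.iterate_succ_apply']
    obtain ⟨q, hq, e⟩ := fullIter_prec_succ ha hd hb (hpos m) u
    have : b u ^ 2 / (q + a u) ≤ b u ^ 2 / a u :=
      div_le_div_of_nonneg_left (sq_nonneg _) (ha u) (by linarith [hpos m 0])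
    rw [e]
    linarith

lemma tendsto_iterate_prec_zero_div {s : (Fin (U + 1) → ℝ) × (Fin (U + 1) → ℝ)}
    (hs : ∀ i, 0 < s.2 i) :
    Tendsto (fun m : ℕ => ((fullIter a b d)^[m] s).2 0 / m) atTop (𝓝 (∑ u, a u)) := by
  refine tendsto_div_nat_of_tendsto_sub (f := fun m => ((fullIter a b d)^[m] s).2 0) ?_
  have h : Tendsto (fun m => ∑ u, (a u - b u ^ 2 / (((fullIter a b d)^[m] s).2 u.succ + d u)))
      atTop (𝓝 (∑ u, (a u - 0))) :=
    tendsto_finsetSum _ fun u _ => tendsto_const_nhds.sub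
      ((tendsto_atTop_add_const_right _ _
        (tendsto_iterate_prec_succ ha hd hb hs u)).const_div_atTop _)
  simp only [sub_zero] at h
  refine h.congr fun m => ?_
  rw [Function.iterate_succ_apply', fullIter_prec_zero]
  ring

lemma tendsto_iterate_prec_succ_div (hU : U ≠ 0)
    {s : (Fin (U + 1) → ℝ) × (Fin (U + 1) → ℝ)} (hs : ∀ i, 0 < s.2 i) (u : Fin U) :
    Tendsto (fun m : ℕ => ((fullIter a b d)^[m] s).2 u.succ / m) atTop (𝓝 (d u)) := by
  have hpos := iterate_fullIter_prec_pos ha hd hb hs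
  choose q hq e using fun m => fullIter_prec_succ ha hd hb (hpos m) u
  refine tendsto_div_nat_of_tendsto_sub (f := fun m => ((fullIter a b d)^[m] s).2 u.succ) ?_
  have hq' : Tendsto q atTop atTop :=
    tendsto_atTop_mono hq (tendsto_iterate_prec_zero ha hd hb hU hs)
  have h : Tendsto (fun m => d u - b u ^ 2 / (q m + a u)) atTop (𝓝 (d u - 0)) :=
    tendsto_const_nhds.sub ((tendsto_atTop_add_const_right _ _ hq').const_div_atTop _)
  rw [sub_zero] at h
  refine h.congr fun m => ?_
  rw [Function.iterate_succ_apply', e]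
  ring

lemma tendsto_iterate_mean_sq (hU : U ≠ 0)
    (hcond : ∀ u, b u ^ 2 < 4 * a u * d u ^ 2 * (∑ k, a k) / (d u + ∑ k, a k) ^ 2)
    {s : (Fin (U + 1) → ℝ) × (Fin (U + 1) → ℝ)} (hs : ∀ i, 0 < s.2 i) :
    Tendsto (fun m => ∑ i, ((fullIter a b d)^[m] s).1 i ^ 2) atTop (𝓝 0) := by
  have : NeZero U := ⟨hU⟩
  have hpos := iterate_fullIter_prec_pos ha hd hb hs
  have hA : 0 < ∑ k, a k := Finset.sum_pos (fun u _ => ha u) Finset.univ_nonempty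
  choose δ hδ hmargin using fun u => exists_discriminant_margin (ha u) (hd u) hA (hcond u)
  obtain ⟨ε, hε, hεδ⟩ : ∃ ε > 0, ∀ u, ε < δ u := by
    have h : ∀ᶠ ε in 𝓝[>] (0 : ℝ), ∀ u, ε < δ u :=
      eventually_all.2 fun u => mem_nhdsWithin_of_mem_nhds (gt_mem_nhds (hδ u))
    obtain ⟨ε, h, hε⟩ := (h.and self_mem_nhdsWithin).exists
    exact ⟨ε, hε, h⟩
  have hp := tendsto_iterate_prec_zero_div ha hd hb hs
  have hlow : Tendsto (fun m : ℕ => ((((fullIter a b d)^[m] s).2 0 + ∑ k, a k) / m)⁻¹)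
      atTop (𝓝 (∑ k, a k)⁻¹) := by
    have h := hp.add (tendsto_const_div_atTop_nhds_zero_nat (∑ k, a k))
    rw [add_zero] at h
    exact (h.congr fun m => (add_div _ _ _).symm).inv₀ hA.ne'
  have hhigh := hp.inv₀ hA.ne'
  have ht := fun u => (tendsto_iterate_prec_succ_div ha hd hb hU hs u).inv₀ (hd u).ne'
  have ev : ∀ᶠ m : ℕ in atTop, ∀ u,
      |((((fullIter a b d)^[m] s).2 0 + ∑ k, a k) / m)⁻¹ - (∑ k, a k)⁻¹| < δ u ∧
      |(((fullIter a b d)^[m] s).2 0 / m)⁻¹ - (∑ k, a k)⁻¹| < δ u ∧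
      |(((fullIter a b d)^[m] s).2 u.succ / m)⁻¹ - (d u)⁻¹| < δ u :=
    eventually_all.2 fun u =>
      (Metric.tendsto_nhds.1 hlow _ (hδ u)).and
        ((Metric.tendsto_nhds.1 hhigh _ (hδ u)).and (Metric.tendsto_nhds.1 (ht u) _ (hδ u)))
  refine tendsto_zero_of_harmonic_contraction (ε := 2 * ε) (by linarith)
    (fun m => Finset.sum_nonneg fun i _ => sq_nonneg _) ?_
  filter_upwards [ev, eventually_gt_atTop 0] with m hm hm0
  have hm0' : (0 : ℝ) < m := Nat.cast_pos.2 hm0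
  have hr : 1 ≤ 1 + 2 * (ε / m) := by
    have := div_pos hε hm0'
    linarith
  have hstep := fullIter_sq_le ha hd hb hU (inv_le_one_of_one_le₀ hr) (hpos m)
    (fun u p hp1 hp2 x y x' y' e1 e2 => by
      have hp0 : 0 < p := (hpos m 0).trans_le hp1
      have htu := hpos m u.succ
      obtain ⟨l1, l2, l3⟩ := hm u
      rw [inv_div] at l1 l2 l3
      have b1 : (m : ℝ) / (((fullIter a b d)^[m] s).2 0 + ∑ k, a k) ≤ m / p :=
        div_le_div_of_nonneg_left hm0'.le hp0 hp2
      have b2 : (m : ℝ) / p ≤ m / ((fullIter a b d)^[m] s).2 0 :=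
        div_le_div_of_nonneg_left hm0'.le (hpos m 0) hp1
      have l4 : |(m : ℝ) / p - (∑ k, a k)⁻¹| < δ u := by
        rw [abs_lt] at *
        constructor <;> linarith [l1.1, l2.2]
      obtain ⟨c1, c2⟩ := hmargin u ε hε (hεδ u) _ _ l4 l3
      have f1 : ε / m < a u / p := by
        rw [div_lt_iff₀ hm0']
        calc ε < a u * (m / p) := c1
          _ = a u / p * m := by ring
      have f2 : (b u * (1 / p + 1 / ((fullIter a b d)^[m] s).2 u.succ)) ^ 2
          ≤ 4 * (a u / p - ε / m) * (d u / ((fullIter a b d)^[m] s).2 u.succ - ε / m) := by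
        have hmm : (0 : ℝ) < (m : ℝ) ^ 2 := by positivity
        have hε' : ε = ε / m * m := (div_mul_cancel₀ _ hm0'.ne').symm
        generalize hκ : ε / (m : ℝ) = κ at hε' ⊢
        rw [hε'] at c2
        refine le_of_mul_le_mul_right ?_ hmm
        calc _ = (b u * (m / p + m / ((fullIter a b d)^[m] s).2 u.succ)) ^ 2 := by ring
          _ ≤ _ := c2
          _ = _ := by ring
      rw [inv_mul_eq_div, le_div_iff₀' (by linarith)]
      exact sq_norm_contracts hp0 htu f1 f2 e1 e2)
  rw [Function.iterate_succ_apply']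
  rw [inv_mul_eq_div, le_div_iff₀' (by linarith)] at hstep
  refine le_trans (mul_le_mul_of_nonneg_right ?_
    (Finset.sum_nonneg fun i _ => sq_nonneg _)) hstep
  rw [← mul_div_assoc]
  gcongr
  linarith

end FullIteration

/-- Under the convergence condition
`b_u² < 4 a_u d_u² (Σ_k a_k)/(d_u + Σ_k a_k)²` for every unit `u`, the marginalized
Gaussian Bayes recursion started from an arbitrary mean `μ₀` and arbitrary positive
precisions `τ₀` satisfies `|μ_m|₂ → 0` and `τ_m^{(i)} → ∞` for every coordinate `i`:
the iterates converge to a point mass at the MLE (translated to the origin). -/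
theorem marginalized_bayes_converges {U : ℕ} (hU : 2 ≤ U)
    (Λ : Fin U → Matrix (Fin 2) (Fin 2) ℝ)
    (hsymm : ∀ u, (Λ u).IsSymm) (hpd : ∀ u, (Λ u).PosDef)
    (hcond : ∀ u, (Λ u 0 1) ^ 2 <
      4 * Λ u 0 0 * (Λ u 1 1) ^ 2 * (∑ k, Λ k 0 0) / (Λ u 1 1 + ∑ k, Λ k 0 0) ^ 2)
    (μ0 τ0 : Fin (U + 1) → ℝ) (hτ0 : ∀ i, 0 < τ0 i) :
    Filter.Tendsto
      (fun m : ℕ => Real.sqrt (∑ i,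
        (((fullIter (fun u => Λ u 0 0) (fun u => Λ u 0 1) (fun u => Λ u 1 1))^[m]
          (μ0, τ0)).1 i) ^ 2))
      Filter.atTop (nhds 0) ∧
    ∀ i : Fin (U + 1),
      Filter.Tendsto
        (fun m : ℕ =>
          ((fullIter (fun u => Λ u 0 0) (fun u => Λ u 0 1) (fun u => Λ u 1 1))^[m]
            (μ0, τ0)).2 i)
        Filter.atTop Filter.atTop := by
  have ha : ∀ u, 0 < Λ u 0 0 := fun u => (hpd u).diag_pos
  have hd : ∀ u, 0 < Λ u 1 1 := fun u => (hpd u).diag_pos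
  have hb : ∀ u, Λ u 0 1 ^ 2 < Λ u 0 0 * Λ u 1 1 := fun u => by
    have h := (hpd u).det_pos
    rw [Matrix.det_fin_two, (hsymm u).apply 0 1] at h
    linarith
  have hU0 : U ≠ 0 := by omega
  refine ⟨?_, Fin.cases (tendsto_iterate_prec_zero ha hd hb hU0 hτ0)
    (tendsto_iterate_prec_succ ha hd hb hτ0)⟩
  have h := (tendsto_iterate_mean_sq ha hd hb hU0 hcond (s := (μ0, τ0)) hτ0).sqrt
  rwa [Real.sqrt_zero] at h
end

section
/- Fix an integer U ≥ 2 and, for each u ∈ {1,…,U}, a symmetric positive definite matrix Λ_u ∈ ℝ^{2×2} with entries a_u = [Λ_u]_{1,1}, b_u = [Λ_u]_{1,2}, d_u = [Λ_u]_{2,2}, and suppose that for every u the condition b_u² < 4 a_u d_u² (Σ_{k=1}^U a_k) / (d_u + Σ_{k=1}^U a_k)² holds. Let (s_m)_{m≥1} be a sequence of positive perturbation precisions with m/s_m → 0 as m → ∞. Let (μ′_m, τ′_m) be the state of the perturbed marginalized Gaussian Bayes recursion after m full iterations, started from an arbitrary mean vector μ′_0 ∈ ℝ^{U+1} and arbitrary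 positive initial precisions τ′_0 ∈ (0,∞)^{U+1}, where in full iteration m each sub-iteration is preceded by replacing each precision coordinate τ^{(i)} by τ^{(i)} s_m/(τ^{(i)} + s_m) while leaving the mean unchanged (the effect of convolving the Gaussian with independent mean-zero Gaussian noise of precision s_m in each coordinate). Then |μ′_m|₂ → 0 and every coordinate of τ′_m tends to +∞ as m → ∞; i.e. the perturbed marginalized data cloning iterates converge to a point mass at the maximum likelihood estimate (translated to the origin). -/
/-- Perturbation of the precisions with noise precision `s`: each precision coordinate
`τ⁽ⁱ⁾` is replaced by `τ⁽ⁱ⁾ s/(τ⁽ⁱ⁾ + s)` (the effect of convolving the Gaussian with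
independent mean-zero Gaussian noise of precision `s` in each coordinate), while the
mean is unchanged. -/
noncomputable def perturb {U : ℕ} (s : ℝ)
    (st : (Fin (U + 1) → ℝ) × (Fin (U + 1) → ℝ)) :
    (Fin (U + 1) → ℝ) × (Fin (U + 1) → ℝ) :=
  (st.1, fun i => st.2 i * s / (st.2 i + s))

/-- One full iteration of the perturbed marginalized Gaussian Bayes recursion with
noise precision `s`: each sub-iteration (for `u = 1, …, U` in order) is preceded by
the perturbation of the precisions. -/
noncomputable def pertFullIter {U : ℕ} (a b dd : Fin U → ℝ) (s : ℝ)
    (st : (Fin (U + 1) → ℝ) × (Fin (U + 1) → ℝ)) :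
    (Fin (U + 1) → ℝ) × (Fin (U + 1) → ℝ) :=
  (List.finRange U).foldl (fun st u => subIter a b dd u (perturb s st)) st

/-- The state of the perturbed marginalized Gaussian Bayes recursion after `m` full
iterations, where full iteration number `m` uses the perturbation precision `s m`. -/
noncomputable def pertState {U : ℕ} (a b dd : Fin U → ℝ) (s : ℕ → ℝ)
    (init : (Fin (U + 1) → ℝ) × (Fin (U + 1) → ℝ)) :
    ℕ → (Fin (U + 1) → ℝ) × (Fin (U + 1) → ℝ)
  | 0 => init
  | m + 1 => pertFullIter a b dd (s (m + 1)) (pertState a b dd s init m)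

open Filter Finset

section ScalarSequences

lemma eventually_le_of_clamped_drift {x h : ℕ → ℝ} {K δ : ℝ} (hδ : 0 < δ)
    (hh : ∀ n, |h n| ≤ K)
    (hx : ∀ᶠ n in atTop, x (n + 1) ≤ max (x n) 0 + (h n - h (n + 1)) - δ) :
    ∀ᶠ n in atTop, x n ≤ 2 * K := by
  obtain ⟨N, hN⟩ := eventually_atTop.1 hx
  have hstep : ∀ n, N ≤ n → x (n + 1) + h (n + 1) ≤ max (x n + h n) K - δ := by
    intro n hn
    have h1 := hN n hn
    have h2 := le_of_abs_le (hh n)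
    rcases le_total (x n) 0 with h0 | h0
    · rw [max_eq_right h0] at h1
      linarith [le_max_right (x n + h n) K]
    · rw [max_eq_left h0] at h1
      linarith [le_max_left (x n + h n) K]
  have hbound : ∀ j : ℕ, x (N + j) + h (N + j) ≤ max (x N + h N - j * δ) K := by
    intro j
    induction j with
    | zero => simp
    | succ j ih =>
      have h1 := hstep (N + j) (by omega)
      have h2 : max (x (N + j) + h (N + j)) K ≤ max (x N + h N - j * δ) K :=
        max_le ih (le_max_right _ _)
      push_cast
      rw [← add_assoc]
      rcases le_total (x N + h N - j * δ) K with h3 | h3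
      · rw [max_eq_right h3] at h2
        exact le_trans (by linarith) (le_max_right _ _)
      · rw [max_eq_left h3] at h2
        exact le_trans (by linarith) (le_max_left _ _)
  obtain ⟨J, hJ⟩ := exists_nat_ge ((x N + h N - K) / δ)
  refine eventually_atTop.2 ⟨N + J, fun n hn => ?_⟩
  obtain ⟨j, rfl⟩ := Nat.exists_eq_add_of_le (show N ≤ n by omega)
  have h1 := hbound j
  have hJj : (J : ℝ) ≤ j := by exact_mod_cast (by omega : J ≤ j)
  have h2 : x N + h N - j * δ ≤ K := by
    have := (div_le_iff₀ hδ).1 (hJ.trans hJj)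
    linarith
  rw [max_eq_right h2] at h1
  linarith [neg_le_of_abs_le (hh (N + j))]

lemma exists_bounded_corrector {U : ℕ} (hU : 0 < U) {g : ℕ → ℝ}
    (hg : Function.Periodic g U) :
    ∃ (h : ℕ → ℝ) (K : ℝ), (∀ n, |h n| ≤ K) ∧
      ∀ n, h n - h (n + 1) = g n - (∑ j ∈ range U, g j) / U := by
  have hU' : (U : ℝ) ≠ 0 := by positivity
  set G := ∑ j ∈ range U, g j with hG
  let h : ℕ → ℝ := fun n => n * (G / U) - ∑ j ∈ range n, g j
  have hstep : ∀ n, h n - h (n + 1) = g n - G / U := by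
    intro n
    simp only [h, sum_range_succ]
    push_cast
    ring
  have hper : Function.Periodic h U := by
    intro n
    induction n with
    | zero => simp [h, ← hG]; field_simp; simp
    | succ n ih =>
      have h1 := hstep n
      have h2 := hstep (n + U)
      rw [hg n] at h2
      rw [show n + 1 + U = n + U + 1 by omega]
      linarith
  refine ⟨h, ∑ k ∈ range U, |h k|, fun n => ?_, hstep⟩
  rw [← hper.map_mod_nat n]
  exact single_le_sum (f := fun k => |h k|) (fun _ _ => abs_nonneg _)
    (mem_range.2 (Nat.mod_lt _ hU))

lemma eventually_le_of_periodic_drift {U : ℕ} (hU : 0 < U) {g : ℕ → ℝ}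
    (hg : Function.Periodic g U) (hneg : ∑ j ∈ range U, g j < 0) :
    ∃ η > 0, ∃ K : ℝ, ∀ x : ℕ → ℝ,
      (∀ᶠ n in atTop, x (n + 1) ≤ max (x n) 0 + g n + η) → ∀ᶠ n in atTop, x n ≤ K := by
  obtain ⟨h, K, hK, hh⟩ := exists_bounded_corrector hU hg
  have hUpos : (0 : ℝ) < U := by exact_mod_cast hU
  have hq : (∑ j ∈ range U, g j) / U < 0 := div_neg_of_neg_of_pos hneg hUpos
  refine ⟨-((∑ j ∈ range U, g j) / U) / 2, by linarith, 2 * K, fun x hx => ?_⟩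
  refine eventually_le_of_clamped_drift (δ := -((∑ j ∈ range U, g j) / U) / 2)
    (by linarith) hK ?_
  filter_upwards [hx] with n hn
  rw [hh]
  linarith

lemma tendsto_zero_of_harmonic_contraction_s6 {W : ℕ → ℝ} {κ : ℝ} (hκ : 0 < κ)
    (hW : ∀ n, 0 ≤ W n)
    (hstep : ∀ᶠ n : ℕ in atTop, W (n + 1) + κ * (1 / ((n : ℝ) + 1)) * W (n + 1) ≤ W n) :
    Tendsto W atTop (nhds 0) := by
  obtain ⟨N, hN⟩ := eventually_atTop.1 hstep
  let S : ℕ → ℝ := fun n => ∑ i ∈ range n, (1 / ((i : ℝ) + 1))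
  have hS : Tendsto S atTop atTop := Real.tendsto_sum_range_one_div_nat_succ_atTop
  have hmain : ∀ n, N ≤ n → 0 ≤ S n - S N ∧ (κ * (S n - S N) + 1) * W n ≤ W N := by
    intro n hn
    induction n, hn using Nat.le_induction with
    | base => simp
    | succ n hn ih =>
      obtain ⟨h0, h1⟩ := ih
      have h2 := hN n hn
      have hs : S (n + 1) = S n + 1 / ((n : ℝ) + 1) := sum_range_succ _ _
      have hp : (0 : ℝ) ≤ 1 / ((n : ℝ) + 1) := by positivity
      refine ⟨by linarith, ?_⟩
      have h3 : W (n + 1) ≤ W n := by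
        have := mul_nonneg (mul_nonneg hκ.le hp) (hW (n + 1))
        linarith
      have h4 : κ * (S n - S N) * W (n + 1) ≤ κ * (S n - S N) * W n :=
        mul_le_mul_of_nonneg_left h3 (mul_nonneg hκ.le h0)
      rw [hs]
      linarith
  have hlim : Tendsto (fun n => W N / (κ * (S n - S N) + 1)) atTop (nhds 0) := by
    refine Tendsto.div_atTop tendsto_const_nhds ?_
    refine tendsto_atTop_add_const_right _ _ (Tendsto.const_mul_atTop hκ ?_)
    simpa only [sub_eq_add_neg] using tendsto_atTop_add_const_right _ (-S N) hS
  refine squeeze_zero' (Eventually.of_forall hW) ?_ hlim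
  filter_upwards [eventually_ge_atTop N] with n hn
  obtain ⟨h0, h1⟩ := hmain n hn
  rw [le_div_iff₀ (by have := mul_nonneg hκ.le h0; linarith)]
  linarith

end ScalarSequences

section Perturbation

/-- The precision of the sum of independent Gaussians with precisions `t` and `s`. -/
noncomputable def parallelSum (t s : ℝ) : ℝ := t * s / (t + s)

lemma parallelSum_pos {t s : ℝ} (ht : 0 < t) (hs : 0 < s) : 0 < parallelSum t s := by
  unfold parallelSum; positivity

lemma parallelSum_le_left {t s : ℝ} (ht : 0 < t) (hs : 0 < s) : parallelSum t s ≤ t := by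
  unfold parallelSum
  rw [div_le_iff₀ (by positivity)]
  nlinarith

lemma parallelSum_mono {t t' s : ℝ} (ht : 0 < t) (hs : 0 < s) (h : t ≤ t') :
    parallelSum t s ≤ parallelSum t' s := by
  unfold parallelSum
  rw [div_le_div_iff₀ (by positivity) (by linarith)]
  nlinarith [mul_le_mul_of_nonneg_right h (sq_nonneg s)]

lemma mul_parallelSum_le {c t s : ℝ} (hc : 0 < c) (hc1 : c ≤ 1) (ht : 0 < t) (hs : 0 < s) :
    c * parallelSum t s ≤ parallelSum (c * t) s := by
  unfold parallelSum
  rw [← mul_div_assoc, div_le_div_iff₀ (by positivity) (by positivity)]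
  have : 0 ≤ c * t ^ 2 * s * (1 - c) :=
    mul_nonneg (by positivity) (by linarith)
  linarith

lemma parallelSum_sub_le {t t' s : ℝ} (ht : 0 < t) (ht' : 0 < t') (hs : 0 < s) :
    parallelSum t s - parallelSum t' s ≤ max (t - t') 0 := by
  rcases le_total t t' with h | h
  · exact le_max_of_le_right (by linarith [parallelSum_mono ht hs h])
  · refine le_max_of_le_left ?_
    unfold parallelSum
    rw [div_sub_div _ _ (by positivity) (by positivity), div_le_iff₀ (by positivity)]
    have : 0 ≤ (t - t') * (t * t' + t * s + t' * s) :=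
      mul_nonneg (by linarith) (by positivity)
    linarith

lemma sub_parallelSum_le {t T s : ℝ} (ht : 0 < t) (hT : 0 < T) (hs : 0 < s) :
    T - parallelSum t s ≤ max (T - t) 0 + T ^ 2 / s := by
  have h1 := parallelSum_sub_le hT ht hs
  have h2 : T - parallelSum T s ≤ T ^ 2 / s := by
    unfold parallelSum
    rw [sub_div' (by positivity), div_le_div_iff₀ (by positivity) hs]
    nlinarith [pow_pos hT 3]
  linarith

lemma tendsto_parallelSum_atTop {t σ : ℕ → ℝ} (ht : Tendsto t atTop atTop)
    (hσ : Tendsto σ atTop atTop) :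
    Tendsto (fun n => parallelSum (t n) (σ n)) atTop atTop := by
  refine tendsto_atTop.2 fun B => ?_
  filter_upwards [ht.eventually_ge_atTop (2 * max B 1),
    hσ.eventually_ge_atTop (2 * max B 1)] with n h1 h2
  have hB := le_max_left B 1
  have hB1 := le_max_right B 1
  unfold parallelSum
  rw [le_div_iff₀ (by linarith)]
  refine (mul_le_mul_of_nonneg_right hB (by linarith)).trans ?_
  nlinarith

lemma tendsto_atTop_of_periodic_gain {U : ℕ} (hU : 0 < U) {t σ g : ℕ → ℝ}
    (hg : Function.Periodic g U) (hpos : 0 < ∑ j ∈ range U, g j)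
    (ht : ∀ n, 0 < t n) (hσ : ∀ n, 0 < σ n) (hσ' : Tendsto σ atTop atTop)
    (hstep : ∀ n, parallelSum (t n) (σ n) + g n ≤ t (n + 1)) :
    Tendsto t atTop atTop := by
  obtain ⟨η, hη, K, hK⟩ := eventually_le_of_periodic_drift (g := fun n => -g n) hU
    (fun n => by simp [hg n]) (by simpa using hpos)
  refine tendsto_atTop.2 fun B => ?_
  set T := max (B + K) 1 with hT
  have hT0 : 0 < T := lt_of_lt_of_le one_pos (le_max_right _ _)
  have hsmall : ∀ᶠ n in atTop, T ^ 2 / σ n < η :=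
    (tendsto_const_nhds.div_atTop hσ').eventually_lt_const hη
  have := hK (fun n => T - t n) (by
    filter_upwards [hsmall] with n hn
    have h1 := hstep n
    have h2 := sub_parallelSum_le (ht n) hT0 (hσ n)
    linarith)
  filter_upwards [this] with n hn
  linarith [le_max_left (B + K) 1]

lemma exists_eventually_mul_sub_le {U : ℕ} (hU : 0 < U) {t t' σ g g' E E' : ℕ → ℝ} {c : ℝ}
    (hc : 0 < c) (hc1 : c ≤ 1)
    (hg : Function.Periodic g U) (hg' : Function.Periodic g' U)
    (hlt : c * ∑ j ∈ range U, g j < ∑ j ∈ range U, g' j)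
    (ht : ∀ n, 0 < t n) (ht' : ∀ n, 0 < t' n) (hσ : ∀ n, 0 < σ n)
    (hE : Tendsto E atTop (nhds 0)) (hE' : Tendsto E' atTop (nhds 0))
    (hstep : ∀ n, t (n + 1) = parallelSum (t n) (σ n) + g n - E n)
    (hstep' : ∀ n, t' (n + 1) = parallelSum (t' n) (σ n) + g' n - E' n) :
    ∃ K, ∀ᶠ n in atTop, c * t n - t' n ≤ K := by
  obtain ⟨η, hη, K, hK⟩ := eventually_le_of_periodic_drift
    (g := fun n => c * g n - g' n) hU (fun n => by simp [hg n, hg' n])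
    (by rw [sum_sub_distrib, ← mul_sum]; linarith)
  refine ⟨K, hK _ ?_⟩
  have hlim : Tendsto (fun n => E' n - c * E n) atTop (nhds 0) := by
    simpa using hE'.sub (hE.const_mul c)
  filter_upwards [hlim.eventually_lt_const hη] with n hn
  rw [hstep, hstep']
  have h1 := mul_parallelSum_le hc hc1 (ht n) (hσ n)
  have h2 := parallelSum_sub_le (mul_pos hc (ht n)) (ht' n) (hσ n)
  linarith

/-- Along sequences whose gains per period compare favourably, the ratio of the perturbed
precisions is eventually bounded by every constant below the critical one. -/
lemma eventually_mul_parallelSum_le {U : ℕ} (hU : 0 < U) {t t' σ g g' E E' : ℕ → ℝ}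
    {c c₁ : ℝ} (hc : 0 < c) (hcc₁ : c < c₁) (hc₁ : c₁ ≤ 1)
    (hg : Function.Periodic g U) (hg' : Function.Periodic g' U)
    (hlt : c₁ * ∑ j ∈ range U, g j < ∑ j ∈ range U, g' j)
    (ht : ∀ n, 0 < t n) (ht' : ∀ n, 0 < t' n) (hσ : ∀ n, 0 < σ n)
    (htop : Tendsto t atTop atTop)
    (hE : Tendsto E atTop (nhds 0)) (hE' : Tendsto E' atTop (nhds 0))
    (hstep : ∀ n, t (n + 1) = parallelSum (t n) (σ n) + g n - E n)
    (hstep' : ∀ n, t' (n + 1) = parallelSum (t' n) (σ n) + g' n - E' n) :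
    ∀ᶠ n in atTop, c * parallelSum (t n) (σ n) ≤ parallelSum (t' n) (σ n) := by
  obtain ⟨K, hK⟩ := exists_eventually_mul_sub_le hU (hc.trans hcc₁) hc₁ hg hg' hlt ht ht' hσ
    hE hE' hstep hstep'
  filter_upwards [hK, htop.eventually_ge_atTop (K / (c₁ - c))] with n h1 h2
  rw [div_le_iff₀ (by linarith)] at h2
  exact (mul_parallelSum_le hc (by linarith) (ht n) (hσ n)).trans
    (parallelSum_mono (mul_pos hc (ht n)) (hσ n) (by linarith))

end Perturbation

section MeanContraction

lemma mean_update_contracts {a b d p q κ x₀ x₁ y₀ y₁ : ℝ} (ha : 0 < a) (hp : 0 < p)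
    (hq : 0 < q) (hκ : κ < 1)
    (hdisc : b ^ 2 * (p + q) ^ 2 ≤ (1 - κ) ^ 2 * (4 * a * d) * (p * q))
    (h₀ : p * x₀ = (p + a) * y₀ + b * y₁) (h₁ : q * x₁ = b * y₀ + (q + d) * y₁) :
    y₀ ^ 2 + y₁ ^ 2 + 2 * κ * (a * y₀ ^ 2 / p + d * y₁ ^ 2 / q) ≤ x₀ ^ 2 + x₁ ^ 2 := by
  have e₀ : x₀ = y₀ + (a * y₀ + b * y₁) / p := by field_simp; linarith
  have e₁ : x₁ = y₁ + (b * y₀ + d * y₁) / q := by field_simp; linarith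
  have hA : 0 < (1 - κ) * a * q := mul_pos (mul_pos (by linarith) ha) hq
  have hform : 0 ≤ (1 - κ) * a * q * y₀ ^ 2 + b * (p + q) * (y₀ * y₁)
      + (1 - κ) * d * p * y₁ ^ 2 := by
    refine nonneg_of_mul_nonneg_right (a := 4 * ((1 - κ) * a * q)) ?_ (by linarith)
    have h1 := mul_nonneg (sub_nonneg.2 hdisc) (sq_nonneg y₁)
    have h2 := sq_nonneg (2 * ((1 - κ) * a * q) * y₀ + b * (p + q) * y₁)
    linarith
  have hquad : κ * (a * y₀ ^ 2 / p + d * y₁ ^ 2 / q)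
      ≤ y₀ * ((a * y₀ + b * y₁) / p) + y₁ * ((b * y₀ + d * y₁) / q) := by
    have : y₀ * ((a * y₀ + b * y₁) / p) + y₁ * ((b * y₀ + d * y₁) / q)
        - κ * (a * y₀ ^ 2 / p + d * y₁ ^ 2 / q)
        = ((1 - κ) * a * q * y₀ ^ 2 + b * (p + q) * (y₀ * y₁)
      + (1 - κ) * d * p * y₁ ^ 2) / (p * q) := by
      field_simp
      ring
    have := this ▸ div_nonneg hform (mul_pos hp hq).le
    linarith
  rw [e₀, e₁]
  nlinarith [sq_nonneg ((a * y₀ + b * y₁) / p), sq_nonneg ((b * y₀ + d * y₁) / q)]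

lemma sq_mul_add_sq_le_of_ratio {B M p q c : ℝ} (hB : 0 ≤ B) (hp : 0 < p) (hq : 0 < q)
    (hc : 0 < c) (hc1 : c ≤ 1) (hcB : B * (1 + c) ^ 2 ≤ M * c) (hqp : q ≤ p)
    (hcp : c * p ≤ q) : B * (p + q) ^ 2 ≤ M * (p * q) := by
  have h1 : 0 ≤ (q - c * p) * (p - c * q) :=
    mul_nonneg (by linarith) (by nlinarith)
  have h2 : c * (p + q) ^ 2 ≤ (1 + c) ^ 2 * (p * q) := by linarith
  have h3 := mul_le_mul_of_nonneg_left h2 hB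
  have h4 := mul_le_mul_of_nonneg_right hcB (mul_pos hp hq).le
  refine le_of_mul_le_mul_left ?_ hc
  linarith

lemma exists_lt_sq_mul_lt {B M t : ℝ} (ht : 0 < t) (h : B * (1 + t) ^ 2 < M * t) :
    ∃ c, 0 < c ∧ c < t ∧ B * (1 + c) ^ 2 < M * c := by
  have h1 : ∀ᶠ c in nhds t, B * (1 + c) ^ 2 < M * c :=
    ContinuousAt.eventually_lt (by fun_prop) (by fun_prop) h
  obtain ⟨c, ⟨h2, h3⟩, h4⟩ := (((h1.and (eventually_gt_nhds ht)).filter_mono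
    nhdsWithin_le_nhds).and (self_mem_nhdsWithin (s := Set.Iio t))).exists
  exact ⟨c, h3, h4, h2⟩

lemma exists_contraction_constants {a b d A : ℝ} (ha : 0 < a) (hd : 0 < d) (hA : 0 < A)
    (hdet : b ^ 2 < a * d) (hcond : b ^ 2 < 4 * a * d ^ 2 * A / (d + A) ^ 2) :
    ∃ c c' κ : ℝ, 0 < c ∧ c < min 1 (d / A) ∧ 0 < c' ∧ c' < min 1 (A / d) ∧ 0 < κ ∧ κ < 1 ∧
      ∀ p q : ℝ, 0 < p → 0 < q → c * p ≤ q → c' * q ≤ p →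
        b ^ 2 * (p + q) ^ 2 ≤ (1 - κ) ^ 2 * (4 * a * d) * (p * q) := by
  rw [lt_div_iff₀ (by positivity)] at hcond
  have hone : b ^ 2 * (1 + 1) ^ 2 < 4 * a * d * 1 := by linarith
  have h₁ : b ^ 2 * (1 + min 1 (d / A)) ^ 2 < 4 * a * d * min 1 (d / A) := by
    rcases min_choice 1 (d / A) with h | h <;> rw [h]
    · exact hone
    · rw [show b ^ 2 * (1 + d / A) ^ 2 = b ^ 2 * (d + A) ^ 2 / A ^ 2 by field_simp; ring,
        div_lt_iff₀ (by positivity)]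
      convert hcond using 1
      field_simp
  have h₂ : b ^ 2 * (1 + min 1 (A / d)) ^ 2 < 4 * a * d * min 1 (A / d) := by
    rcases min_choice 1 (A / d) with h | h <;> rw [h]
    · exact hone
    · rw [show b ^ 2 * (1 + A / d) ^ 2 = b ^ 2 * (d + A) ^ 2 / d ^ 2 by field_simp,
        div_lt_iff₀ (by positivity)]
      convert hcond using 1
      field_simp
  obtain ⟨c, hc, hct, hcB⟩ := exists_lt_sq_mul_lt (lt_min one_pos (by positivity)) h₁
  obtain ⟨c', hc', hct', hcB'⟩ := exists_lt_sq_mul_lt (lt_min one_pos (by positivity)) h₂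
  have hk : ∀ e : ℝ, b ^ 2 * (1 + e) ^ 2 < 4 * a * d * e →
      ∀ᶠ κ in nhds (0 : ℝ), b ^ 2 * (1 + e) ^ 2 < (1 - κ) ^ 2 * (4 * a * d) * e := by
    intro e he
    refine ContinuousAt.eventually_lt (by fun_prop) (by fun_prop) ?_
    simpa using he
  obtain ⟨κ, ⟨hκ1, hκ2, hκ3⟩, hκ0⟩ := ((((hk c hcB).and ((hk c' hcB').and
    (eventually_lt_nhds (one_pos (α := ℝ))))).filter_mono nhdsWithin_le_nhds).and
    (self_mem_nhdsWithin (s := Set.Ioi (0 : ℝ)))).exists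
  refine ⟨c, c', κ, hc, hct, hc', hct', hκ0, hκ3, fun p q hp hq hcp hcq => ?_⟩
  rcases le_total q p with h | h
  · exact sq_mul_add_sq_le_of_ratio (sq_nonneg b) hp hq hc
      (hct.le.trans (min_le_left _ _)) hκ1.le h hcp
  · rw [add_comm p q, mul_comm p q]
    exact sq_mul_add_sq_le_of_ratio (sq_nonneg b) hq hp hc'
      (hct'.le.trans (min_le_left _ _)) hκ2.le h hcq

end MeanContraction

section FlatRecursion

/-- Positivity of the marginalized precision matrices. -/
structure PositiveBlocks {U : ℕ} (a b d : Fin U → ℝ) : Prop where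
  shared_pos : ∀ u, 0 < a u
  unit_pos : ∀ u, 0 < d u
  det_pos : ∀ u, b u ^ 2 < a u * d u

lemma PositiveBlocks.sq_div_lt_shared {U : ℕ} {a b d : Fin U → ℝ} (h : PositiveBlocks a b d) (u : Fin U)
    {q : ℝ} (hq : 0 ≤ q) : b u ^ 2 / (q + d u) ≤ b u ^ 2 / d u ∧ b u ^ 2 / d u < a u := by
  have hd := h.unit_pos u
  refine ⟨div_le_div_of_nonneg_left (sq_nonneg _) hd (by linarith), ?_⟩
  rw [div_lt_iff₀ hd]
  exact h.det_pos u

lemma PositiveBlocks.sq_div_lt_unit {U : ℕ} {a b d : Fin U → ℝ} (h : PositiveBlocks a b d) (u : Fin U)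
    {p : ℝ} (hp : 0 ≤ p) : b u ^ 2 / (p + a u) ≤ b u ^ 2 / a u ∧ b u ^ 2 / a u < d u := by
  have ha := h.shared_pos u
  refine ⟨div_le_div_of_nonneg_left (sq_nonneg _) ha (by linarith), ?_⟩
  rw [div_lt_iff₀ ha, mul_comm]
  exact h.det_pos u

lemma subIter_mean {U : ℕ} (a b d : Fin U → ℝ) (u : Fin U)
    (st : (Fin (U + 1) → ℝ) × (Fin (U + 1) → ℝ))
    (hdet : (st.2 0 + a u) * (st.2 u.succ + d u) - b u * b u ≠ 0) :
    st.2 0 * st.1 0 = (st.2 0 + a u) * (subIter a b d u st).1 0 +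
        b u * (subIter a b d u st).1 u.succ ∧
      st.2 u.succ * st.1 u.succ = b u * (subIter a b d u st).1 0 +
        (st.2 u.succ + d u) * (subIter a b d u st).1 u.succ := by
  set N : Matrix (Fin 2) (Fin 2) ℝ := !![st.2 0 + a u, b u; b u, st.2 u.succ + d u] with hN
  set D : Matrix (Fin 2) (Fin 2) ℝ := !![st.2 0, 0; 0, st.2 u.succ] with hD
  have hunit : IsUnit N.det := by
    rw [hN, Matrix.det_fin_two_of]
    exact hdet.isUnit
  have hM : N * (N⁻¹ * D) = D := Matrix.mul_nonsing_inv_cancel_left _ _ hunit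
  have h₀ : (subIter a b d u st).1 0 =
      (N⁻¹ * D) 0 0 * st.1 0 + (N⁻¹ * D) 0 1 * st.1 u.succ := by
    simp only [subIter, if_true, ← hN, ← hD]
  have h₁ : (subIter a b d u st).1 u.succ =
      (N⁻¹ * D) 1 0 * st.1 0 + (N⁻¹ * D) 1 1 * st.1 u.succ := by
    simp only [subIter, if_true, Fin.succ_ne_zero, if_false, ← hN, ← hD]
  rw [h₀, h₁]
  generalize N⁻¹ * D = M at hM
  have e := fun i j => congrFun (congrFun hM i) j
  have e₀₀ := e 0 0
  have e₀₁ := e 0 1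
  have e₁₀ := e 1 0
  have e₁₁ := e 1 1
  simp [hN, hD, Matrix.mul_apply, Fin.sum_univ_two] at e₀₀ e₀₁ e₁₀ e₁₁
  constructor
  · linear_combination -st.1 0 * e₀₀ - st.1 u.succ * e₀₁
  · linear_combination -st.1 0 * e₁₀ - st.1 u.succ * e₁₁

variable {U : ℕ} [NeZero U]

/-- The state of the perturbed recursion after `n` sub-iterations. -/
noncomputable def flatState (a b d : Fin U → ℝ) (s : ℕ → ℝ)
    (init : (Fin (U + 1) → ℝ) × (Fin (U + 1) → ℝ)) :
    ℕ → (Fin (U + 1) → ℝ) × (Fin (U + 1) → ℝ)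
  | 0 => init
  | n + 1 => subIter a b d (Fin.ofNat U n) (perturb (s (n / U + 1)) (flatState a b d s init n))

lemma pertState_eq_flatState (a b d : Fin U → ℝ) (s : ℕ → ℝ)
    (init : (Fin (U + 1) → ℝ) × (Fin (U + 1) → ℝ)) (m : ℕ) :
    pertState a b d s init m = flatState a b d s init (U * m) := by
  induction m with
  | zero => rfl
  | succ m ih =>
    have hpos : 0 < U := NeZero.pos U
    have hfold : ∀ k ≤ U, (List.range k).foldl (fun st j =>
        subIter a b d (Fin.ofNat U j) (perturb (s (m + 1)) st))
        (flatState a b d s init (U * m)) = flatState a b d s init (U * m + k) := by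
      intro k hk
      induction k with
      | zero => rfl
      | succ k ihk =>
        rw [List.range_succ, List.foldl_append, ihk (by omega)]
        have h1 : (U * m + k) / U = m := by
          rw [Nat.mul_add_div hpos, Nat.div_eq_of_lt (by omega), add_zero]
        have h2 : Fin.ofNat U (U * m + k) = Fin.ofNat U k := by
          ext
          simp
        rw [← add_assoc, flatState, h1, h2]
        rfl
    rw [mul_add, mul_one, ← hfold U le_rfl, pertState, pertFullIter, ih,
      ← List.map_coe_finRange_eq_range, List.foldl_map]
    simp

/-- The limiting gain of the `i`-th precision in the `n`-th sub-iteration. -/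
noncomputable def gain (a d : Fin U → ℝ) (i : Fin (U + 1)) (n : ℕ) : ℝ :=
  Fin.cases (a (Fin.ofNat U n)) (fun u => if Fin.ofNat U n = u then d u else 0) i

lemma periodic_comp_ofNat (f : Fin U → ℝ) :
    Function.Periodic (fun n => f (Fin.ofNat U n)) U := by
  intro n
  have : Fin.ofNat U (n + U) = Fin.ofNat U n := by ext; simp
  simp only [this]

lemma sum_range_comp_ofNat (f : Fin U → ℝ) :
    ∑ n ∈ range U, f (Fin.ofNat U n) = ∑ u, f u := by
  rw [Finset.sum_range]
  simp

lemma periodic_gain (a d : Fin U → ℝ) (i : Fin (U + 1)) :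
    Function.Periodic (gain a d i) U := by
  refine Fin.cases ?_ (fun u => ?_) i
  · exact periodic_comp_ofNat a
  · exact periodic_comp_ofNat fun v => if v = u then d u else 0

lemma sum_gain_zero (a d : Fin U → ℝ) : ∑ n ∈ range U, gain a d 0 n = ∑ u, a u :=
  sum_range_comp_ofNat a

lemma sum_gain_succ (a d : Fin U → ℝ) (u : Fin U) :
    ∑ n ∈ range U, gain a d u.succ n = d u := by
  refine (sum_range_comp_ofNat fun v => if v = u then d u else 0).trans ?_
  simp

/-- Scalar form of the perturbed recursion, one sub-iteration at a time: `t` are the precisions,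
`x` the means and `σ` the noise precisions. -/
structure IsPerturbedRecursion (a b d : Fin U → ℝ) (σ : ℕ → ℝ) (t x : ℕ → Fin (U + 1) → ℝ) :
    Prop where
  blocks : PositiveBlocks a b d
  noise_pos : ∀ n, 0 < σ n
  pos : ∀ n i, 0 < t n i
  shared : ∀ n, t (n + 1) 0 = parallelSum (t n 0) (σ n) + a (Fin.ofNat U n) -
    b (Fin.ofNat U n) ^ 2 /
      (parallelSum (t n (Fin.ofNat U n).succ) (σ n) + d (Fin.ofNat U n))
  unit : ∀ n, t (n + 1) (Fin.ofNat U n).succ =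
    parallelSum (t n (Fin.ofNat U n).succ) (σ n) + d (Fin.ofNat U n) -
      b (Fin.ofNat U n) ^ 2 / (parallelSum (t n 0) (σ n) + a (Fin.ofNat U n))
  other : ∀ n u, u ≠ Fin.ofNat U n → t (n + 1) u.succ = parallelSum (t n u.succ) (σ n)
  mean_shared : ∀ n, parallelSum (t n 0) (σ n) * x n 0 =
    (parallelSum (t n 0) (σ n) + a (Fin.ofNat U n)) * x (n + 1) 0 +
      b (Fin.ofNat U n) * x (n + 1) (Fin.ofNat U n).succ
  mean_unit : ∀ n, parallelSum (t n (Fin.ofNat U n).succ) (σ n) * x n (Fin.ofNat U n).succ =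
    b (Fin.ofNat U n) * x (n + 1) 0 +
      (parallelSum (t n (Fin.ofNat U n).succ) (σ n) + d (Fin.ofNat U n)) *
        x (n + 1) (Fin.ofNat U n).succ
  mean_other : ∀ n u, u ≠ Fin.ofNat U n → x (n + 1) u.succ = x n u.succ

lemma isPerturbedRecursion_flatState {a b d : Fin U → ℝ} (h : PositiveBlocks a b d) {s : ℕ → ℝ}
    (hs : ∀ m, 1 ≤ m → 0 < s m) (init : (Fin (U + 1) → ℝ) × (Fin (U + 1) → ℝ))
    (h0 : ∀ i, 0 < init.2 i) :
    IsPerturbedRecursion a b d (fun n => s (n / U + 1))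
      (fun n => (flatState a b d s init n).2) (fun n => (flatState a b d s init n).1) := by
  have hs' : ∀ n : ℕ, 0 < s (n / U + 1) := fun n => hs _ (Nat.le_add_left 1 _)
  have hshared : ∀ n, (flatState a b d s init (n + 1)).2 0 = _ :=
    fun n => by simp only [flatState, subIter, perturb, if_true]; rfl
  have hunit : ∀ n, (flatState a b d s init (n + 1)).2 (Fin.ofNat U n).succ = _ :=
    fun n => by
      simp only [flatState, subIter, perturb, if_true, Fin.succ_ne_zero, if_false]; rfl
  have hother : ∀ n u, u ≠ Fin.ofNat U n → (flatState a b d s init (n + 1)).2 u.succ =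
      parallelSum ((flatState a b d s init n).2 u.succ) (s (n / U + 1)) :=
    fun n u hu => by
      simp only [flatState, subIter, perturb, Fin.succ_ne_zero, if_false, Fin.succ_inj, hu,
        parallelSum]
  have hpos : ∀ n i, 0 < (flatState a b d s init n).2 i := by
    intro n
    induction n with
    | zero => exact h0
    | succ n ih =>
      have hp := fun i => parallelSum_pos (ih i) (hs' n)
      intro i
      refine Fin.cases ?_ (fun u => ?_) i
      · rw [hshared]
        obtain ⟨h1, h2⟩ := h.sq_div_lt_shared (Fin.ofNat U n) (hp (Fin.ofNat U n).succ).le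
        have h3 := hp 0
        simp only [parallelSum] at h1 h3
        linarith
      · by_cases hu : u = Fin.ofNat U n
        · rw [hu, hunit]
          obtain ⟨h1, h2⟩ := h.sq_div_lt_unit (Fin.ofNat U n) (hp 0).le
          have h3 := hp (Fin.ofNat U n).succ
          simp only [parallelSum] at h1 h3
          linarith
        · rw [hother n u hu]
          exact hp _
  have hdet : ∀ n, (parallelSum ((flatState a b d s init n).2 0) (s (n / U + 1)) +
      a (Fin.ofNat U n)) * (parallelSum ((flatState a b d s init n).2 (Fin.ofNat U n).succ)
        (s (n / U + 1)) + d (Fin.ofNat U n)) - b (Fin.ofNat U n) * b (Fin.ofNat U n) ≠ 0 := by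
    intro n
    have h1 := h.det_pos (Fin.ofNat U n)
    have h2 := h.shared_pos (Fin.ofNat U n)
    have h3 := h.unit_pos (Fin.ofNat U n)
    have h4 := parallelSum_pos (hpos n 0) (hs' n)
    have h5 := parallelSum_pos (hpos n (Fin.ofNat U n).succ) (hs' n)
    nlinarith [mul_pos h4 h5, mul_pos h4 h3, mul_pos h2 h5]
  refine ⟨h, hs', hpos, hshared, hunit, hother, fun n => ?_, fun n => ?_, fun n u hu => ?_⟩
  · exact (subIter_mean a b d (Fin.ofNat U n)
      (perturb (s (n / U + 1)) (flatState a b d s init n)) (hdet n)).1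
  · exact (subIter_mean a b d (Fin.ofNat U n)
      (perturb (s (n / U + 1)) (flatState a b d s init n)) (hdet n)).2
  · simp only [flatState, subIter, perturb, Fin.succ_ne_zero, if_false, Fin.succ_inj, hu]

end FlatRecursion

namespace IsPerturbedRecursion

variable {U : ℕ} [NeZero U] {a b d : Fin U → ℝ} {σ : ℕ → ℝ} {t x : ℕ → Fin (U + 1) → ℝ}

lemma step_unit (R : IsPerturbedRecursion a b d σ t x) (n : ℕ) (u : Fin U) :
    t (n + 1) u.succ = parallelSum (t n u.succ) (σ n) +
      (if Fin.ofNat U n = u then d u - b u ^ 2 / (parallelSum (t n 0) (σ n) + a u) else 0) := by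
  split_ifs with h
  · subst h
    rw [R.unit]
    ring
  · rw [R.other n u (Ne.symm h), add_zero]

lemma parallelSum_pos (R : IsPerturbedRecursion a b d σ t x) (n : ℕ) (i : Fin (U + 1)) :
    0 < parallelSum (t n i) (σ n) :=
  _root_.parallelSum_pos (R.pos n i) (R.noise_pos n)

lemma lower_gain (R : IsPerturbedRecursion a b d σ t x) (n : ℕ) (i : Fin (U + 1)) :
    parallelSum (t n i) (σ n) +
      gain (fun u => a u - b u ^ 2 / d u) (fun u => d u - b u ^ 2 / a u) i n ≤ t (n + 1) i := by
  refine Fin.cases ?_ (fun u => ?_) i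
  · have := (R.blocks.sq_div_lt_shared (Fin.ofNat U n)
      (R.parallelSum_pos n (Fin.ofNat U n).succ).le).1
    rw [R.shared]
    simp only [gain, Fin.cases_zero]
    linarith
  · rw [R.step_unit]
    simp only [gain, Fin.cases_succ]
    have := (R.blocks.sq_div_lt_unit u (R.parallelSum_pos n 0).le).1
    split_ifs <;> linarith

lemma upper_gain (R : IsPerturbedRecursion a b d σ t x) (n : ℕ) (i : Fin (U + 1)) :
    t (n + 1) i ≤ parallelSum (t n i) (σ n) + gain a d i n := by
  refine Fin.cases ?_ (fun u => ?_) i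
  · have hq := R.parallelSum_pos n (Fin.ofNat U n).succ
    have hd := R.blocks.unit_pos (Fin.ofNat U n)
    have : 0 ≤ b (Fin.ofNat U n) ^ 2 /
      (parallelSum (t n (Fin.ofNat U n).succ) (σ n) + d (Fin.ofNat U n)) := by positivity
    rw [R.shared]
    simp only [gain, Fin.cases_zero]
    linarith
  · have hp := R.parallelSum_pos n 0
    have ha := R.blocks.shared_pos u
    have : 0 ≤ b u ^ 2 / (parallelSum (t n 0) (σ n) + a u) := by positivity
    rw [R.step_unit]
    simp only [gain, Fin.cases_succ]
    split_ifs <;> linarith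

lemma tendsto_precision (R : IsPerturbedRecursion a b d σ t x) (hσ : Tendsto σ atTop atTop)
    (i : Fin (U + 1)) : Tendsto (fun n => t n i) atTop atTop := by
  refine tendsto_atTop_of_periodic_gain (NeZero.pos U) (periodic_gain _ _ i) ?_
    (fun n => R.pos n i) R.noise_pos hσ (fun n => R.lower_gain n i)
  refine Fin.cases ?_ (fun u => ?_) i
  · rw [sum_gain_zero]
    refine sum_pos (fun u _ => ?_) univ_nonempty
    exact sub_pos.2 (R.blocks.sq_div_lt_shared u le_rfl).2
  · rw [sum_gain_succ]
    exact sub_pos.2 (R.blocks.sq_div_lt_unit u le_rfl).2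

lemma tendsto_gain_error (R : IsPerturbedRecursion a b d σ t x) (hσ : Tendsto σ atTop atTop)
    (i : Fin (U + 1)) :
    Tendsto (fun n => parallelSum (t n i) (σ n) + gain a d i n - t (n + 1) i) atTop (nhds 0) := by
  have hlim : ∀ (j : Fin (U + 1)) (r e : ℝ),
      Tendsto (fun n => r / (parallelSum (t n j) (σ n) + e)) atTop (nhds 0) := fun j r e =>
    tendsto_const_nhds.div_atTop (tendsto_atTop_add_const_right _ _
      (tendsto_parallelSum_atTop (R.tendsto_precision hσ j) hσ))
  have hnonneg : ∀ n, 0 ≤ parallelSum (t n i) (σ n) + gain a d i n - t (n + 1) i :=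
    fun n => sub_nonneg.2 (R.upper_gain n i)
  revert hnonneg
  refine Fin.cases (fun hnonneg => ?_) (fun u hnonneg => ?_) i
  · have hsum : Tendsto (fun n => ∑ u : Fin U,
        b u ^ 2 / (parallelSum (t n u.succ) (σ n) + d u)) atTop (nhds 0) := by
      simpa using tendsto_finsetSum univ fun u _ => hlim (Fin.succ u) (b u ^ 2) (d u)
    refine squeeze_zero hnonneg (fun n => ?_) hsum
    have := single_le_sum (f := fun u : Fin U =>
      b u ^ 2 / (parallelSum (t n u.succ) (σ n) + d u)) (fun u _ => by
        have := R.parallelSum_pos n u.succ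
        have := R.blocks.unit_pos u
        positivity) (mem_univ (Fin.ofNat U n))
    rw [R.shared]
    simp only [gain, Fin.cases_zero]
    linarith
  · refine squeeze_zero hnonneg (fun n => ?_) (hlim 0 (b u ^ 2) (a u))
    have hp := R.parallelSum_pos n 0
    have ha := R.blocks.shared_pos u
    have : 0 ≤ b u ^ 2 / (parallelSum (t n 0) (σ n) + a u) := by positivity
    rw [R.step_unit]
    simp only [gain, Fin.cases_succ]
    split_ifs <;> linarith

lemma gain_le (R : IsPerturbedRecursion a b d σ t x) (n : ℕ) (i : Fin (U + 1)) :
    gain a d i n ≤ ∑ u, a u + ∑ u, d u := by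
  have ha := fun u => (R.blocks.shared_pos u).le
  have hd := fun u => (R.blocks.unit_pos u).le
  refine Fin.cases ?_ (fun u => ?_) i
  · simp only [gain, Fin.cases_zero]
    linarith [single_le_sum (fun u _ => ha u) (mem_univ (Fin.ofNat U n)),
      sum_nonneg fun u (_ : u ∈ univ) => hd u]
  · have h1 := single_le_sum (fun u _ => hd u) (mem_univ u)
    have h2 := sum_nonneg fun u (_ : u ∈ univ) => ha u
    simp only [gain, Fin.cases_succ]
    split_ifs <;> linarith [hd u]

lemma exists_precision_le (R : IsPerturbedRecursion a b d σ t x) :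
    ∃ C > 0, ∀ n i, t n i ≤ C * (n + 1) := by
  set B := ∑ u, a u + ∑ u, d u with hB
  have hBpos : 0 < B := add_pos (sum_pos (fun u _ => R.blocks.shared_pos u) univ_nonempty)
    (sum_pos (fun u _ => R.blocks.unit_pos u) univ_nonempty)
  have hT : 0 ≤ ∑ i, t 0 i := sum_nonneg fun i _ => (R.pos 0 i).le
  refine ⟨∑ i, t 0 i + B, by linarith, fun n i => ?_⟩
  induction n with
  | zero =>
    have := single_le_sum (fun i _ => (R.pos 0 i).le) (mem_univ i)
    push_cast
    linarith
  | succ n ih =>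
    have h1 := R.upper_gain n i
    have h2 := parallelSum_le_left (R.pos n i) (R.noise_pos n)
    have h3 := R.gain_le n i
    push_cast
    linarith

lemma exists_step_contraction (R : IsPerturbedRecursion a b d σ t x)
    (hσ : Tendsto σ atTop atTop) (u : Fin U)
    (hcond : b u ^ 2 < 4 * a u * d u ^ 2 * (∑ k, a k) / (d u + ∑ k, a k) ^ 2) :
    ∃ κ > 0, ∀ᶠ n : ℕ in atTop, Fin.ofNat U n = u →
      x (n + 1) 0 ^ 2 + x (n + 1) u.succ ^ 2 +
        κ / (n + 1) * (x (n + 1) 0 ^ 2 + x (n + 1) u.succ ^ 2) ≤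
          x n 0 ^ 2 + x n u.succ ^ 2 := by
  have ha := R.blocks.shared_pos u
  have hd := R.blocks.unit_pos u
  have hA : 0 < ∑ k, a k := sum_pos (fun u _ => R.blocks.shared_pos u) univ_nonempty
  obtain ⟨C, hC, hCt⟩ := R.exists_precision_le
  obtain ⟨c, c', κ, hc, hcm, hc', hcm', hκ, hκ1, hdisc⟩ :=
    exists_contraction_constants ha hd hA (R.blocks.det_pos u) hcond
  obtain ⟨c₁, hc₁, hc₁m⟩ := exists_between hcm
  obtain ⟨c₁', hc₁', hc₁m'⟩ := exists_between hcm'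
  rw [lt_min_iff] at hc₁m hc₁m'
  have hratio : ∀ᶠ n in atTop,
      c * parallelSum (t n 0) (σ n) ≤ parallelSum (t n u.succ) (σ n) := by
    refine eventually_mul_parallelSum_le (NeZero.pos U) hc hc₁ hc₁m.1.le (periodic_gain a d 0)
      (periodic_gain a d u.succ) ?_ (fun n => R.pos n _) (fun n => R.pos n _) R.noise_pos
      (R.tendsto_precision hσ 0) (R.tendsto_gain_error hσ 0) (R.tendsto_gain_error hσ u.succ)
      (fun n => by ring) (fun n => by ring)
    rw [sum_gain_zero, sum_gain_succ]
    exact (lt_div_iff₀ hA).1 hc₁m.2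
  have hratio' : ∀ᶠ n in atTop,
      c' * parallelSum (t n u.succ) (σ n) ≤ parallelSum (t n 0) (σ n) := by
    refine eventually_mul_parallelSum_le (NeZero.pos U) hc' hc₁' hc₁m'.1.le
      (periodic_gain a d u.succ) (periodic_gain a d 0) ?_ (fun n => R.pos n _)
      (fun n => R.pos n _) R.noise_pos (R.tendsto_precision hσ u.succ)
      (R.tendsto_gain_error hσ u.succ) (R.tendsto_gain_error hσ 0)
      (fun n => by ring) (fun n => by ring)
    rw [sum_gain_zero, sum_gain_succ]
    exact (lt_div_iff₀ hd).1 hc₁m'.2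
  refine ⟨2 * κ * min (a u) (d u) / C, div_pos (mul_pos (by linarith) (lt_min ha hd)) hC, ?_⟩
  filter_upwards [hratio, hratio'] with n h1 h2 hn
  have hp := R.parallelSum_pos n 0
  have hq := R.parallelSum_pos n u.succ
  have hshared := R.mean_shared n
  have hunit := R.mean_unit n
  rw [hn] at hshared hunit
  have key := mean_update_contracts ha hp hq hκ1 (hdisc _ _ hp hq h1 h2) hshared hunit
  have hCn : 0 < C * ((n : ℝ) + 1) := by positivity
  have hterm : ∀ (i : Fin (U + 1)) (e y : ℝ), min (a u) (d u) ≤ e → 0 < e →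
      min (a u) (d u) / (C * (n + 1)) * y ^ 2 ≤ e * y ^ 2 / parallelSum (t n i) (σ n) := by
    intro i e y he he0
    rw [mul_div_right_comm]
    refine mul_le_mul_of_nonneg_right ?_ (sq_nonneg y)
    exact div_le_div₀ he0.le he (R.parallelSum_pos n i)
      ((parallelSum_le_left (R.pos n i) (R.noise_pos n)).trans (hCt n i))
  have k1 := hterm 0 (a u) (x (n + 1) 0) (min_le_left _ _) ha
  have k2 := hterm u.succ (d u) (x (n + 1) u.succ) (min_le_right _ _) hd
  have k3 := mul_le_mul_of_nonneg_left (add_le_add k1 k2) (by linarith : 0 ≤ 2 * κ)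
  rw [show 2 * κ * min (a u) (d u) / C / (n + 1) = 2 * κ * (min (a u) (d u) / (C * (n + 1))) by
    field_simp]
  linarith

lemma sum_sq_step (R : IsPerturbedRecursion a b d σ t x) (n : ℕ) :
    ∑ i, x n i ^ 2 - ∑ i, x (n + 1) i ^ 2 =
      x n 0 ^ 2 + x n (Fin.ofNat U n).succ ^ 2 -
        (x (n + 1) 0 ^ 2 + x (n + 1) (Fin.ofNat U n).succ ^ 2) := by
  have : ∑ u : Fin U, (x n u.succ ^ 2 - x (n + 1) u.succ ^ 2) =
      x n (Fin.ofNat U n).succ ^ 2 - x (n + 1) (Fin.ofNat U n).succ ^ 2 :=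
    sum_eq_single _ (fun u _ hu => by rw [R.mean_other n u hu, sub_self])
      fun h => absurd (mem_univ _) h
  rw [sum_sub_distrib] at this
  rw [Fin.sum_univ_succ, Fin.sum_univ_succ]
  linarith

lemma mean_const_after_update (R : IsPerturbedRecursion a b d σ t x) (m : ℕ) (u : Fin U) :
    x (U * m + u + 1) u.succ = x (U * m + U) u.succ := by
  have h : ∀ k, (u : ℕ) + 1 ≤ k → k ≤ U →
      x (U * m + u + 1) u.succ = x (U * m + k) u.succ := by
    intro k hk
    induction k, hk using Nat.le_induction with
    | base => exact fun _ => rfl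
    | succ k hk ih =>
      intro hkU
      rw [ih (by omega), ← add_assoc, R.mean_other]
      intro hu
      have := congrArg Fin.val hu
      simp only [Fin.val_ofNat, Nat.mul_add_mod, Nat.mod_eq_of_lt (show k < U by omega)] at this
      omega
  exact h U u.isLt le_rfl

lemma exists_cycle_contraction (R : IsPerturbedRecursion a b d σ t x)
    (hσ : Tendsto σ atTop atTop)
    (hcond : ∀ u, b u ^ 2 < 4 * a u * d u ^ 2 * (∑ k, a k) / (d u + ∑ k, a k) ^ 2) :
    ∃ κ > 0, ∀ᶠ m : ℕ in atTop,
      ∑ i, x (U * (m + 1)) i ^ 2 +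
        κ * (1 / ((m : ℝ) + 1)) * ∑ i, x (U * (m + 1)) i ^ 2 ≤ ∑ i, x (U * m) i ^ 2 := by
  have hU : 0 < U := NeZero.pos U
  choose κ hκ hev using fun u => R.exists_step_contraction hσ u (hcond u)
  obtain ⟨u₀, -, hu₀⟩ := exists_min_image univ κ univ_nonempty
  refine ⟨κ u₀ / U, div_pos (hκ u₀) (by exact_mod_cast hU), ?_⟩
  obtain ⟨N, hN⟩ := eventually_atTop.1 (eventually_all.2 hev)
  filter_upwards [eventually_ge_atTop N] with m hm
  set ρ := κ u₀ / U * (1 / ((m : ℝ) + 1)) with hρ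
  have hρ0 : 0 ≤ ρ := by
    have := hκ u₀
    positivity
  have hstep : ∀ j < U, ρ * (x (U * m + j + 1) 0 ^ 2 +
      x (U * m + j + 1) (Fin.ofNat U j).succ ^ 2) ≤
        ∑ i, x (U * m + j) i ^ 2 - ∑ i, x (U * m + j + 1) i ^ 2 := by
    intro j hj
    have hv : Fin.ofNat U (U * m + j) = Fin.ofNat U j := by ext; simp
    have hge : N ≤ U * m + j := by nlinarith
    have h1 := hN _ hge (Fin.ofNat U j) hv
    rw [R.sum_sq_step, hv]
    have h2 : ρ ≤ κ (Fin.ofNat U j) / (((U * m + j : ℕ) : ℝ) + 1) := by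
      have h3 : ρ = κ u₀ / (U * (m + 1)) := by rw [hρ]; field_simp
      rw [h3]
      refine div_le_div₀ (hκ _).le (hu₀ _ (mem_univ _)) (by positivity) ?_
      have : U * m + j + 1 ≤ U * (m + 1) := by rw [mul_add]; omega
      exact_mod_cast this
    have h4 := mul_le_mul_of_nonneg_right h2 (add_nonneg (sq_nonneg (x (U * m + j + 1) 0))
      (sq_nonneg (x (U * m + j + 1) (Fin.ofNat U j).succ)))
    linarith
  have hsum := sum_le_sum fun j (hj : j ∈ range U) => hstep j (mem_range.1 hj)
  have htel : ∑ j ∈ range U, (∑ i, x (U * m + j) i ^ 2 - ∑ i, x (U * m + j + 1) i ^ 2) =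
      ∑ i, x (U * m) i ^ 2 - ∑ i, x (U * m + U) i ^ 2 :=
    sum_range_sub' (fun j => ∑ i, x (U * m + j) i ^ 2) U
  rw [htel, ← mul_sum, sum_add_distrib] at hsum
  have hshared : x (U * m + U) 0 ^ 2 ≤ ∑ j ∈ range U, x (U * m + j + 1) 0 ^ 2 := by
    have := single_le_sum (f := fun j => x (U * m + j + 1) 0 ^ 2) (fun _ _ => sq_nonneg _)
      (mem_range.2 (Nat.sub_lt hU one_pos))
    simpa only [add_assoc, Nat.sub_add_cancel (show 1 ≤ U from hU)] using this
  have hunits : ∑ j ∈ range U, x (U * m + j + 1) (Fin.ofNat U j).succ ^ 2 =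
      ∑ u : Fin U, x (U * m + U) u.succ ^ 2 := by
    rw [Finset.sum_range]
    refine sum_congr rfl fun u _ => ?_
    rw [← R.mean_const_after_update m u]
    simp
  rw [hunits] at hsum
  have htot := Fin.sum_univ_succ fun i => x (U * m + U) i ^ 2
  rw [mul_add U m 1, mul_one]
  have h5 : ρ * ∑ i, x (U * m + U) i ^ 2 ≤ ρ * (∑ j ∈ range U, x (U * m + j + 1) 0 ^ 2 +
      ∑ u : Fin U, x (U * m + U) u.succ ^ 2) :=
    mul_le_mul_of_nonneg_left (by linarith) hρ0
  linarith

lemma tendsto_sum_sq (R : IsPerturbedRecursion a b d σ t x) (hσ : Tendsto σ atTop atTop)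
    (hcond : ∀ u, b u ^ 2 < 4 * a u * d u ^ 2 * (∑ k, a k) / (d u + ∑ k, a k) ^ 2) :
    Tendsto (fun m => ∑ i, x (U * m) i ^ 2) atTop (nhds 0) := by
  obtain ⟨κ, hκ, h⟩ := R.exists_cycle_contraction hσ hcond
  exact tendsto_zero_of_harmonic_contraction_s6 hκ (fun n => sum_nonneg fun i _ => sq_nonneg _) h

end IsPerturbedRecursion

lemma positiveBlocks_of_posDef {U : ℕ} {Λ : Fin U → Matrix (Fin 2) (Fin 2) ℝ}
    (hpd : ∀ u, (Λ u).PosDef) :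
    PositiveBlocks (fun u => Λ u 0 0) (fun u => Λ u 0 1) (fun u => Λ u 1 1) := by
  refine ⟨fun u => (hpd u).diag_pos, fun u => (hpd u).diag_pos, fun u => ?_⟩
  have h1 := (hpd u).det_pos
  have h2 : Λ u 1 0 = Λ u 0 1 := by simpa using (hpd u).isHermitian.apply 0 1
  rw [Matrix.det_fin_two, h2] at h1
  linarith

lemma tendsto_atTop_of_tendsto_natCast_div {s : ℕ → ℝ} (hs : ∀ m : ℕ, 1 ≤ m → 0 < s m)
    (hms : Tendsto (fun m : ℕ => (m : ℝ) / s m) atTop (nhds 0)) : Tendsto s atTop atTop := by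
  refine tendsto_atTop_mono' _ ?_ tendsto_natCast_atTop_atTop
  filter_upwards [hms.eventually_lt_const one_pos, eventually_ge_atTop 1] with m h1 h2
  exact ((div_lt_one (hs m h2)).1 h1).le

/-- Under the convergence condition `b_u² < 4 a_u d_u² (Σ_k a_k)/(d_u + Σ_k a_k)²`
for every unit `u`, and with perturbation precisions `s_m > 0` satisfying
`m/s_m → 0` (i.e. perturbation variances `σ_m² = o(1/m)`), the perturbed marginalized
Gaussian Bayes recursion started from an arbitrary mean `μ₀` and arbitrary positive
precisions `τ₀` satisfies `|μ'_m|₂ → 0` and `τ'_m{}^{(i)} → ∞` for every coordinate: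
the perturbed marginalized data cloning iterates converge to a point mass at the MLE
(translated to the origin). -/
theorem perturbed_marginalized_bayes_converges {U : ℕ} (hU : 2 ≤ U)
    (Λ : Fin U → Matrix (Fin 2) (Fin 2) ℝ)
    (hsymm : ∀ u, (Λ u).IsSymm) (hpd : ∀ u, (Λ u).PosDef)
    (hcond : ∀ u, (Λ u 0 1) ^ 2 <
      4 * Λ u 0 0 * (Λ u 1 1) ^ 2 * (∑ k, Λ k 0 0) / (Λ u 1 1 + ∑ k, Λ k 0 0) ^ 2)
    (s : ℕ → ℝ) (hs : ∀ m : ℕ, 1 ≤ m → 0 < s m)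
    (hms : Filter.Tendsto (fun m : ℕ => (m : ℝ) / s m) Filter.atTop (nhds 0))
    (μ0 τ0 : Fin (U + 1) → ℝ) (hτ0 : ∀ i, 0 < τ0 i) :
    Filter.Tendsto
      (fun m : ℕ => Real.sqrt (∑ i,
        ((pertState (fun u => Λ u 0 0) (fun u => Λ u 0 1) (fun u => Λ u 1 1) s
          (μ0, τ0) m).1 i) ^ 2))
      Filter.atTop (nhds 0) ∧
    ∀ i : Fin (U + 1),
      Filter.Tendsto
        (fun m : ℕ =>
          (pertState (fun u => Λ u 0 0) (fun u => Λ u 0 1) (fun u => Λ u 1 1) s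
            (μ0, τ0) m).2 i)
        Filter.atTop Filter.atTop := by
  have : NeZero U := ⟨by omega⟩
  have R := isPerturbedRecursion_flatState (positiveBlocks_of_posDef hpd) hs (μ0, τ0) hτ0
  have hσ : Filter.Tendsto (fun n => s (n / U + 1)) Filter.atTop Filter.atTop :=
    (tendsto_atTop_of_tendsto_natCast_div hs hms).comp
      ((Filter.tendsto_add_atTop_nat 1).comp (Nat.tendsto_div_const_atTop (NeZero.ne U)))
  simp only [pertState_eq_flatState]
  refine ⟨?_, fun i => ?_⟩
  · simpa using (R.tendsto_sum_sq hσ hcond).sqrt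
  · exact (R.tendsto_precision hσ i).comp
      (Filter.tendsto_id.const_mul_atTop' (NeZero.pos U))
end

section
/- Let U ≥ 1 be an integer and ρ ∈ [0, 1). For every unit u ∈ {1,…,U} let the precision matrix be Λ*_u = [[1, ρ], [ρ, 1]]⁻¹, so that [Λ*_u]_{1,1} = [Λ*_u]_{2,2} = 1/(1 − ρ²) and [Λ*_u]_{1,2} = −ρ/(1 − ρ²). Then the convergence condition [Λ*_u]_{1,2}² < 4 [Λ*_u]_{1,1} [Λ*_u]_{2,2}² (Σ_{k=1}^U [Λ*_k]_{1,1}) / ([Λ*_u]_{2,2} + Σ_{k=1}^U [Λ*_k]_{1,1})² holds (simultaneously for all u) if and only if ρ < 2√U/(U + 1), i.e. if and only if ρ < 2/(√U (1 + 1/U)). -/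
/-- For identical units with likelihood precision matrices
`Λ*_u = [[1, ρ], [ρ, 1]]⁻¹`, i.e. `[Λ*_u]₁₁ = [Λ*_u]₂₂ = 1/(1 − ρ²)` and
`[Λ*_u]₁₂ = −ρ/(1 − ρ²)`, the convergence condition
`[Λ*_u]₁₂² < 4 [Λ*_u]₁₁ [Λ*_u]₂₂² (Σ_k [Λ*_k]₁₁)/([Λ*_u]₂₂ + Σ_k [Λ*_k]₁₁)²`
(simultaneously for all `u`) holds if and only if `ρ < 2√U/(U + 1)`,
i.e. if and only if `ρ < 2/(√U (1 + 1/U))`. -/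
theorem convergence_condition_identical_units (U : ℕ) (hU : 1 ≤ U)
    (ρ : ℝ) (hρ0 : 0 ≤ ρ) (hρ1 : ρ < 1) :
    (∀ _u : Fin U,
      (-ρ / (1 - ρ ^ 2)) ^ 2 <
        4 * (1 / (1 - ρ ^ 2)) * (1 / (1 - ρ ^ 2)) ^ 2 *
            (∑ _k : Fin U, 1 / (1 - ρ ^ 2)) /
          (1 / (1 - ρ ^ 2) + ∑ _k : Fin U, 1 / (1 - ρ ^ 2)) ^ 2) ↔
    ρ < 2 * Real.sqrt U / (U + 1) := by
  have hL : 0 < 1 / (1 - ρ ^ 2) := by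
    have : 0 < 1 - ρ ^ 2 := by nlinarith
    positivity
  have hneg : -ρ / (1 - ρ ^ 2) = -ρ * (1 / (1 - ρ ^ 2)) := by ring
  rw [hneg]
  generalize 1 / (1 - ρ ^ 2) = L at hL ⊢
  have : Nonempty (Fin U) := ⟨⟨0, hU⟩⟩
  have hbound : 4 * L * L ^ 2 * (U * L) / (L + U * L) ^ 2 =
      (2 * Real.sqrt U / (U + 1)) ^ 2 * L ^ 2 := by
    have hsum : L + U * L = L * (U + 1) := by ring
    have hU1 : (U : ℝ) + 1 ≠ 0 := by positivity
    rw [hsum, div_pow, mul_pow 2, Real.sq_sqrt (Nat.cast_nonneg U)]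
    field_simp
    ring
  rw [forall_const, Finset.sum_const, Finset.card_univ, Fintype.card_fin, nsmul_eq_mul,
    hbound, mul_pow, neg_sq, mul_lt_mul_iff_left₀ (by positivity),
    sq_lt_sq₀ hρ0 (by positivity)]
end

section
/- Let α > 0, and let (s_m)_{m≥1} be a sequence of positive reals with m/s_m → 0 as m → ∞. If (t_m)_{m≥0} is a sequence of positive reals satisfying t_{m+1} ≥ t_m s_m/(t_m + s_m) + α for every m ≥ 1, then t_m → ∞ as m → ∞. -/
/-- The shrinkage `t ↦ t s / (t + s)` is monotone in `t` on the positive reals. -/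
theorem mul_div_add_le_mul_div_add {s x y : ℝ} (hs : 0 < s) (hy : 0 < y) (hyx : y ≤ x) :
    y * s / (y + s) ≤ x * s / (x + s) := by
  rw [div_le_div_iff₀ (by linarith) (by linarith)]
  nlinarith [mul_le_mul_of_nonneg_right hyx (mul_pos hs hs).le]

/-- Below the level `K`, shrinkage with a precision `s ≥ K ^ 2 / δ` loses at most `δ`. -/
theorem min_le_mul_div_add_add {s x K δ : ℝ} (hs : 0 < s) (hx : 0 < x) (hK : 0 < K)
    (hδ : 0 < δ) (h : K ^ 2 ≤ δ * s) :
    min x K ≤ x * s / (x + s) + δ := by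
  have hy : 0 < min x K := lt_min hx hK
  refine le_trans ?_
    (add_le_add_left (mul_div_add_le_mul_div_add hs hy (min_le_left x K)) δ)
  have hyK : min x K ≤ K := min_le_right x K
  generalize min x K = y at hy hyK
  rw [← sub_le_iff_le_add, le_div_iff₀ (by linarith)]
  nlinarith [pow_le_pow_left₀ hy.le hyK 2, mul_pos hδ hy]

/-- If `α > 0`, the perturbation precisions `s_m > 0` satisfy `m/s_m → 0`, and the
positive sequence `t_m` satisfies `t_{m+1} ≥ t_m s_m/(t_m + s_m) + α` for all `m ≥ 1`,
then `t_m → ∞`. -/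
theorem perturbed_precision_tendsto_atTop (α : ℝ) (hα : 0 < α) (s t : ℕ → ℝ)
    (hs : ∀ m : ℕ, 1 ≤ m → 0 < s m)
    (hms : Filter.Tendsto (fun m : ℕ => (m : ℝ) / s m) Filter.atTop (nhds 0))
    (ht : ∀ m : ℕ, 0 < t m)
    (hrec : ∀ m : ℕ, 1 ≤ m → t m * s m / (t m + s m) + α ≤ t (m + 1)) :
    Filter.Tendsto t Filter.atTop Filter.atTop := by
  refine Filter.tendsto_atTop.2 fun B => ?_
  obtain ⟨K, hBK, hK⟩ : ∃ K, B ≤ K ∧ 0 < K :=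
    ⟨max B 1, le_max_left _ _, lt_max_of_lt_right one_pos⟩
  have hε : 0 < α / 2 / K ^ 2 := by positivity
  obtain ⟨N, hN⟩ := Filter.eventually_atTop.1
    ((hms.eventually_lt_const hε).and (Filter.eventually_ge_atTop 1))
  have hstep : ∀ m, N ≤ m → min (t m) K + α / 2 ≤ t (m + 1) := by
    intro m hm
    obtain ⟨hlt, h1⟩ := hN m hm
    have hsm := hs m h1
    have h1' : (1 : ℝ) ≤ m := by exact_mod_cast h1
    have hKs : K ^ 2 ≤ α / 2 * s m := by
      rw [div_lt_div_iff₀ hsm (by positivity)] at hlt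
      nlinarith [mul_le_mul_of_nonneg_right h1' (sq_nonneg K)]
    linarith [hrec m h1, min_le_mul_div_add_add hsm (ht m) hK (half_pos hα) hKs]
  have hlower : ∀ j : ℕ, min (j * (α / 2)) K ≤ t (N + j) := by
    intro j
    induction j with
    | zero => simpa using Or.inl (ht N).le
    | succ j ih =>
      refine le_trans ?_ (hstep (N + j) (Nat.le_add_right N j))
      refine le_trans ?_ (add_le_add_left (le_min ih (min_le_right _ _)) (α / 2))
      rw [min_add]
      refine min_le_min (le_of_eq ?_) (by linarith)
      push_cast
      ring
  obtain ⟨J, hJ⟩ := exists_nat_ge (K / (α / 2))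
  filter_upwards [Filter.eventually_ge_atTop (N + J)] with m hm
  obtain ⟨j, rfl⟩ := Nat.exists_eq_add_of_le (le_trans (Nat.le_add_right N J) hm)
  have hJj : (J : ℝ) ≤ j := by exact_mod_cast Nat.le_of_add_le_add_left hm
  have hKj : K ≤ j * (α / 2) := (div_le_iff₀ (half_pos hα)).1 (hJ.trans hJj)
  exact hBK.trans ((le_min hKj le_rfl).trans (hlower j))
end

section
/- Let Θ ⊂ ℝ^d be a compact set, let f : Θ → (0, ∞) be continuous with a unique maximizer θ̂ ∈ Θ (i.e. f(θ) < f(θ̂) for all θ ∈ Θ with θ ≠ θ̂), and let π₀ : Θ → [0, ∞) be a continuous probability density on Θ (with respect to Lebesgue measure restricted to Θ) with π₀(θ̂) > 0 and such that θ̂ is in the closure of the interior of {θ ∈ Θ : π₀(θ) > 0}. For each m ≥ 1 define the m-th data cloning posterior as the probability measure π_m(A) = (∫_A f(θ)^m π₀(θ) dθ) / (∫_Θ f(θ)^m π₀(θ) dθ) for Borel sets A ⊆ Θ. Then for every ε > 0, π_m({θ ∈ Θ : |θ − θ̂|₂ ≥ ε}) → 0 as m → ∞; that is, the iterated posteriors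 concentrate all their mass at the maximum likelihood estimate θ̂. -/
open MeasureTheory

/-- Data cloning concentrates at the MLE: if `f` is a continuous positive likelihood on
a compact set `Θ ⊂ ℝ^d` with unique maximizer `θ̂`, and `π₀` is a continuous
probability density on `Θ` with `π₀(θ̂) > 0` and `θ̂` in the closure of the interior of
`{θ ∈ Θ : π₀(θ) > 0}`, then the `m`-th data cloning posterior
`π_m(A) = ∫_A f^m π₀ / ∫_Θ f^m π₀` assigns vanishing mass to the complement of every
Euclidean ball around `θ̂`. -/
theorem data_cloning_concentrates {d : ℕ}
    (Θ : Set (EuclideanSpace ℝ (Fin d))) (hΘ : IsCompact Θ)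
    (f π₀ : EuclideanSpace ℝ (Fin d) → ℝ) (θhat : EuclideanSpace ℝ (Fin d))
    (hf : ContinuousOn f Θ) (hfpos : ∀ θ ∈ Θ, 0 < f θ)
    (hθhat : θhat ∈ Θ) (hmax : ∀ θ ∈ Θ, θ ≠ θhat → f θ < f θhat)
    (hπ : ContinuousOn π₀ Θ) (hπnn : ∀ θ ∈ Θ, 0 ≤ π₀ θ)
    (hπint : ∫ θ in Θ, π₀ θ = 1)
    (hπpos : 0 < π₀ θhat)
    (hcl : θhat ∈ closure (interior {θ | θ ∈ Θ ∧ 0 < π₀ θ})) :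
    ∀ ε > 0,
      Filter.Tendsto
        (fun m : ℕ =>
          (∫ θ in {θ | θ ∈ Θ ∧ ε ≤ ‖θ - θhat‖}, (f θ) ^ m * π₀ θ) /
            (∫ θ in Θ, (f θ) ^ m * π₀ θ))
        Filter.atTop (nhds 0) := by
  intro ε hε
  let K : Set (EuclideanSpace ℝ (Fin d)) := {θ | θ ∈ Θ ∧ ε ≤ ‖θ - θhat‖}
  have hKΘ : K ⊆ Θ := fun θ h => h.1
  have hKc : IsCompact K :=
    hΘ.inter_right (isClosed_le continuous_const (by fun_prop : Continuous fun θ => ‖θ - θhat‖))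
  have hΘm : MeasurableSet Θ := hΘ.isClosed.measurableSet
  have hKm : MeasurableSet K := hKc.isClosed.measurableSet
  obtain ⟨a, ha0, hab, haK⟩ : ∃ a, 0 < a ∧ a < f θhat ∧ ∀ θ ∈ K, f θ ≤ a := by
    rcases K.eq_empty_or_nonempty with h | h
    · exact ⟨f θhat / 2, half_pos (hfpos _ hθhat), half_lt_self (hfpos _ hθhat), by simp [h]⟩
    · obtain ⟨k, hk, hkmax⟩ := hKc.exists_isMaxOn h (hf.mono hKΘ)
      refine ⟨f k, hfpos k hk.1, hmax k hk.1 ?_, fun θ hθ => hkmax hθ⟩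
      rintro rfl
      have := hk.2
      simp only [sub_self, norm_zero] at this
      linarith
  obtain ⟨c, hac, hcb⟩ := exists_between hab
  have hc0 : 0 < c := ha0.trans hac
  obtain ⟨U, hUo, hθU, hU⟩ := mem_nhdsWithin.1 ((hf θhat hθhat).eventually_const_lt hcb)
  let V := U ∩ interior {θ | θ ∈ Θ ∧ 0 < π₀ θ}
  have hVo : IsOpen V := hUo.inter isOpen_interior
  have hVne : V.Nonempty := mem_closure_iff.1 hcl U hUo hθU
  have hVS : ∀ θ ∈ V, θ ∈ Θ ∧ 0 < π₀ θ := fun θ h =>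
    (interior_subset : _ ⊆ {θ | θ ∈ Θ ∧ 0 < π₀ θ}) h.2
  have hVΘ : V ⊆ Θ := fun θ h => (hVS θ h).1
  have hπi : IntegrableOn π₀ Θ := hπ.integrableOn_compact hΘ
  have hfi (m : ℕ) : IntegrableOn (fun θ => f θ ^ m * π₀ θ) Θ :=
    ((hf.pow m).mul hπ).integrableOn_compact hΘ
  have hnn (m : ℕ) : ∀ θ ∈ Θ, 0 ≤ f θ ^ m * π₀ θ := fun θ h =>
    mul_nonneg (pow_nonneg (hfpos θ h).le m) (hπnn θ h)
  have hD : 0 < ∫ θ in V, π₀ θ := by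
    rw [setIntegral_pos_iff_support_of_nonneg_ae
      (ae_restrict_of_forall_mem hVo.measurableSet fun θ h => (hVS θ h).2.le) (hπi.mono_set hVΘ),
      Set.inter_eq_right.2 (show V ⊆ Function.support π₀ from fun θ h => (hVS θ h).2.ne')]
    exact hVo.measure_pos volume hVne
  have hden (m : ℕ) : c ^ m * ∫ θ in V, π₀ θ ≤ ∫ θ in Θ, f θ ^ m * π₀ θ := by
    rw [← integral_const_mul]
    refine (setIntegral_mono_on ((hπi.mono_set hVΘ).const_mul _) ((hfi m).mono_set hVΘ)
      hVo.measurableSet fun θ h => ?_).trans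
      (setIntegral_mono_set (hfi m) (ae_restrict_of_forall_mem hΘm (hnn m))
        hVΘ.eventuallyLE)
    have hcf : c < f θ := hU ⟨h.1, hVΘ h⟩
    exact mul_le_mul_of_nonneg_right (pow_le_pow_left₀ hc0.le hcf.le m) (hVS θ h).2.le
  have hnum (m : ℕ) : ∫ θ in K, f θ ^ m * π₀ θ ≤ a ^ m := by
    calc ∫ θ in K, f θ ^ m * π₀ θ ≤ ∫ θ in K, a ^ m * π₀ θ :=
          setIntegral_mono_on ((hfi m).mono_set hKΘ) ((hπi.mono_set hKΘ).const_mul _) hKm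
            fun θ h => mul_le_mul_of_nonneg_right
              (pow_le_pow_left₀ (hfpos θ h.1).le (haK θ h) m) (hπnn θ h.1)
      _ = a ^ m * ∫ θ in K, π₀ θ := integral_const_mul _ _
      _ ≤ a ^ m * 1 := by
          gcongr
          rw [← hπint]
          exact setIntegral_mono_set hπi (ae_restrict_of_forall_mem hΘm hπnn) hKΘ.eventuallyLE
      _ = a ^ m := mul_one _
  have hlim : Filter.Tendsto (fun m : ℕ => (a / c) ^ m / ∫ θ in V, π₀ θ) Filter.atTop (nhds 0) := by
    simpa using (tendsto_pow_atTop_nhds_zero_of_lt_one (div_pos ha0 hc0).le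
      ((div_lt_one hc0).2 hac)).div_const (∫ θ in V, π₀ θ)
  refine squeeze_zero (fun m => div_nonneg
    (setIntegral_nonneg hKm fun θ h => hnn m θ h.1) (setIntegral_nonneg hΘm (hnn m)))
    (fun m => ?_) hlim
  rw [div_pow, div_div]
  exact div_le_div₀ (pow_nonneg ha0.le m) (hnum m) (mul_pos (pow_pos hc0 m) hD) (hden m)
end
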